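/- arXiv:2102.00370 — 7 statements merged into one kernel-verified Lean document; each statement's English description precedes it below -/
import Mathlib

section
/- Let F_n = 2^(2^n) + 1 denote the n-th Fermat number. Call a positive integer A anti-elite if the Jacobi symbol (A / F_n) equals 1 for all sufficiently large positive integers n. Then for each ε > 0 there exist constants C and x₀ (depending on ε) such that for all x > x₀, the number of anti-elite integers A with 1 < A ≤ x is at most C · x / (log x)^(1-ε). -/
/-- The primes `p ≤ Y` with `p ≡ 1 [MOD 2 ^ k]`. -/
def primesOneMod (k Y : ℕ) : Finset ℕ :=
  (Finset.range (Y + 1)).filter fun p => p.Prime ∧ 2 ^ k ∣ p - 1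

theorem mem_primesOneMod {k Y p : ℕ} :
    p ∈ primesOneMod k Y ↔ p ≤ Y ∧ p.Prime ∧ 2 ^ k ∣ p - 1 := by
  simp [primesOneMod]

theorem primesOneMod_eq_image {k Y p : ℕ} (hp : p ∈ primesOneMod k Y) :
    ∃ j ∈ Finset.Icc 1 (Y / 2 ^ k), 2 ^ k * j + 1 = p := by
  obtain ⟨hY, hp, j, hj⟩ := mem_primesOneMod.1 hp
  have h2 := hp.two_le
  refine ⟨j, Finset.mem_Icc.2 ⟨?_, ?_⟩, by omega⟩
  · rcases Nat.eq_zero_or_pos j with rfl | h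
    · omega
    · exact h
  · rw [Nat.le_div_iff_mul_le (by positivity), mul_comm]
    omega

theorem card_primesOneMod_mul_le (k Y : ℕ) : (primesOneMod k Y).card * 2 ^ k ≤ Y := by
  have h : (primesOneMod k Y).card ≤ Y / 2 ^ k := by
    calc (primesOneMod k Y).card
        ≤ ((Finset.Icc 1 (Y / 2 ^ k)).image fun j => 2 ^ k * j + 1).card :=
          Finset.card_le_card fun p hp => Finset.mem_image.2 (primesOneMod_eq_image hp)
      _ ≤ _ := Finset.card_image_le.trans (by simp)
  exact (Nat.mul_le_mul_right _ h).trans (Nat.div_mul_le_self _ _)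

/-- A divisor of `N!` that is coprime to `Q` divides `∏_{j ≤ N} (Q j + 1)`. -/
theorem dvd_prod_mul_add_one {M N Q : ℕ} (hM : M ∣ N.factorial) (hMQ : M.Coprime Q) :
    M ∣ ∏ j ∈ Finset.Icc 1 N, (Q * j + 1) := by
  rcases eq_or_ne M 0 with rfl | hM0
  · exact absurd (zero_dvd_iff.1 hM) N.factorial_ne_zero
  obtain ⟨u, hu⟩ : ∃ u : ℕ, u * Q ≡ 1 [MOD M] := by
    obtain ⟨u, hu⟩ := Nat.exists_mul_mod_eq_of_coprime 1 hMQ.symm hM0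
    exact ⟨u, by rw [mul_comm]; exact hu.2⟩
  have huM : M.Coprime u := by
    have : (u * Q).Coprime M := by
      rw [Nat.Coprime, hu.gcd_eq]; simp
    exact (Nat.Coprime.coprime_mul_right this).symm
  have h1 : u ^ N * ∏ j ∈ Finset.Icc 1 N, (Q * j + 1) ≡ (u + 1).ascFactorial N [MOD M] := by
    have hN : u ^ N = ∏ _j ∈ Finset.Icc 1 N, u := by simp
    rw [hN, ← Finset.prod_mul_distrib, Nat.ascFactorial_eq_prod_range,
      Finset.range_eq_Ico, Finset.prod_Ico_add' (fun j => u + j) 0 N 1 |>.symm.trans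
        (Finset.prod_congr rfl fun j _ => by ring) |>.symm]
    rw [show Finset.Ico (0 + 1) (N + 1) = Finset.Icc 1 N from by ext; simp]
    refine Nat.ModEq.prod fun j _ => ?_
    have := (hu.mul_right j).add_right u
    convert this using 1 <;> ring
  exact (huM.pow_right N).dvd_of_dvd_mul_left
    ((h1.dvd_iff dvd_rfl).2 (hM.trans (Nat.factorial_dvd_ascFactorial _ _)))

/-- Chebyshev's argument for the primes `p ≡ 1 [MOD 2 ^ k]` in `(Y / 2 ^ k, Y]`. -/
theorem prod_primesOneMod_gt_le (k Y : ℕ) :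
    ∏ p ∈ (primesOneMod k Y).filter (Y / 2 ^ k < ·), p ≤ 2 ^ ((k + 2) * (Y / 2 ^ k)) := by
  set N := Y / 2 ^ k
  set T := (primesOneMod k Y).filter (N < ·)
  set D := ∏ j ∈ Finset.Icc 1 N, (2 ^ k * j + 1)
  set v := N.factorial.factorization 2
  set M := N.factorial / 2 ^ v
  have hTp : ∀ p ∈ T, p.Prime := fun p hp =>
    (mem_primesOneMod.1 (Finset.mem_filter.1 hp).1).2.1
  have hvM : 2 ^ v * M = N.factorial := Nat.ordProj_mul_ordCompl_eq_self _ _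
  have hMdvd : M ∣ N.factorial := Dvd.intro_left _ hvM
  have hM2 : M.Coprime 2 := (Nat.coprime_ordCompl Nat.prime_two N.factorial_ne_zero).symm
  have hMD : M ∣ D := dvd_prod_mul_add_one hMdvd (hM2.pow_right k)
  have hTD : ∏ p ∈ T, p ∣ D := by
    refine Finset.prod_primes_dvd _ (fun p hp => (hTp p hp).prime) fun p hp => ?_
    obtain ⟨j, hj, rfl⟩ := primesOneMod_eq_image (Finset.mem_filter.1 hp).1
    exact Finset.dvd_prod_of_mem (fun j => 2 ^ k * j + 1) hj
  have hcop : (∏ p ∈ T, p).Coprime M := by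
    refine Nat.Coprime.prod_left fun p hp => ?_
    rw [(hTp p hp).coprime_iff_not_dvd]
    intro h
    have := ((hTp p hp).dvd_factorial).1 (h.trans hMdvd)
    have := (Finset.mem_filter.1 hp).2
    omega
  have hDpos : 0 < D := Finset.prod_pos fun j _ => Nat.succ_pos _
  have hle : (∏ p ∈ T, p) * M ≤ D := Nat.le_of_dvd hDpos (hcop.mul_dvd_of_dvd_of_dvd hTD hMD)
  have hD : D ≤ (2 ^ (k + 1)) ^ N * N.factorial := by
    calc D ≤ ∏ j ∈ Finset.Icc 1 N, (2 ^ (k + 1) * j) := by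
          refine Finset.prod_le_prod' fun j hj => ?_
          have h1 := (Finset.mem_Icc.1 hj).1
          have h2 : 1 ≤ 2 ^ k * j := Nat.mul_pos (by positivity) h1
          rw [pow_succ]; linarith
      _ = _ := by
          rw [Finset.prod_mul_distrib, ← Finset.prod_range_add_one_eq_factorial, Finset.range_eq_Ico,
            Finset.prod_Ico_add' (fun j => j) 0 N 1, show Finset.Ico (0 + 1) (N + 1) =
              Finset.Icc 1 N from by ext; simp]
          simp
  have hv : v ≤ N := by
    have h := sub_one_mul_padicValNat_factorial (p := 2) N
    have h' : v = padicValNat 2 N.factorial := Nat.factorization_def _ Nat.prime_two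
    rw [h', ← one_mul (padicValNat _ _)]
    exact h.trans_le (Nat.sub_le _ _)
  have hMpos : 0 < M := Nat.pos_of_ne_zero fun h => N.factorial_ne_zero (by rw [← hvM, h, mul_zero])
  refine Nat.le_of_mul_le_mul_right ?_ hMpos
  calc (∏ p ∈ T, p) * M ≤ (2 ^ (k + 1)) ^ N * (2 ^ v * M) := by rw [hvM]; exact hle.trans hD
    _ ≤ (2 ^ (k + 1)) ^ N * (2 ^ N * M) := by gcongr; norm_num
    _ = 2 ^ ((k + 2) * N) * M := by rw [← pow_mul, ← mul_assoc, ← pow_add]; ring_nf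

theorem prod_primesOneMod_le (k Y : ℕ) :
    ∏ p ∈ primesOneMod k Y, p ≤ 2 ^ (2 * (k + 2) * (Y / 2 ^ k)) := by
  rcases Nat.eq_zero_or_pos k with rfl | hk
  · have h : ∏ p ∈ primesOneMod 0 Y, p = primorial Y := by simp [primesOneMod, primorial]
    rw [h]
    refine (primorial_le_four_pow Y).trans ?_
    rw [show 4 = 2 ^ 2 from rfl, ← pow_mul]
    refine Nat.pow_le_pow_right (by norm_num) ?_
    simp only [pow_zero, Nat.div_one]
    omega
  induction Y using Nat.strong_induction_on with
  | _ Y ih =>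
    have hQ : 2 ≤ 2 ^ k := Nat.le_self_pow hk.ne' 2
    rcases Nat.eq_zero_or_pos Y with rfl | hY
    · simp [primesOneMod, Finset.filter_singleton, Nat.not_prime_zero]
    have hlt : Y / 2 ^ k < Y := Nat.div_lt_self hY hQ
    have hsub : (primesOneMod k Y).filter (¬ Y / 2 ^ k < ·) = primesOneMod k (Y / 2 ^ k) := by
      ext p
      simp only [Finset.mem_filter, mem_primesOneMod]
      constructor
      · rintro ⟨h, h'⟩; exact ⟨not_lt.1 h', h.2⟩
      · rintro ⟨h, h'⟩; exact ⟨⟨by omega, h'⟩, not_lt.2 h⟩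
    rw [← Finset.prod_filter_mul_prod_filter_not (primesOneMod k Y) (Y / 2 ^ k < ·), hsub]
    refine (Nat.mul_le_mul (prod_primesOneMod_gt_le k Y) (ih _ hlt)).trans ?_
    rw [← pow_add]
    refine Nat.pow_le_pow_right (by norm_num) ?_
    set N := Y / 2 ^ k
    have h2 : 2 * (N / 2 ^ k) ≤ N :=
      (Nat.mul_le_mul_right _ hQ).trans (Nat.mul_div_le _ _)
    nlinarith

theorem card_primesOneMod_mul_log_le (k Y : ℕ) :
    (primesOneMod k Y).card * (Nat.log 2 Y + 1) * 2 ^ k ≤ 8 * (k + 2) * Y := by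
  rcases eq_or_ne Y 0 with rfl | hY
  · simp [primesOneMod, Finset.filter_singleton, Nat.not_prime_zero]
  set h := Nat.log 2 Y / 2
  set T := (primesOneMod k Y).filter (2 ^ h < ·)
  have hle : (primesOneMod k Y).card ≤ T.card + (primesOneMod k (2 ^ h)).card := by
    rw [← Finset.card_filter_add_card_filter_not (s := primesOneMod k Y) (2 ^ h < ·)]
    refine Nat.add_le_add_left (Finset.card_le_card fun p hp => ?_) _
    simp only [Finset.mem_filter, mem_primesOneMod] at hp ⊢
    exact ⟨not_lt.1 hp.2, hp.1.2⟩
  have hT : h * T.card ≤ 2 * (k + 2) * (Y / 2 ^ k) := by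
    rw [← Nat.pow_le_pow_iff_right (a := 2) (by norm_num)]
    calc 2 ^ (h * T.card) = ∏ _p ∈ T, 2 ^ h := by simp [pow_mul]
      _ ≤ ∏ p ∈ T, p := Finset.prod_le_prod' fun p hp => (Finset.mem_filter.1 hp).2.le
      _ ≤ ∏ p ∈ primesOneMod k Y, p :=
          Finset.prod_le_prod_of_subset_of_one_le' (Finset.filter_subset _ _)
            fun p hp _ => (mem_primesOneMod.1 hp).2.1.one_le
      _ ≤ _ := prod_primesOneMod_le k Y
  have hN : 2 ^ k * (Y / 2 ^ k) ≤ Y := Nat.mul_div_le _ _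
  have hc := card_primesOneMod_mul_le k (2 ^ h)
  have hf := card_primesOneMod_mul_le k Y
  have hh : h * 2 ^ h ≤ Y := by
    calc h * 2 ^ h ≤ 2 ^ h * 2 ^ h := Nat.mul_le_mul_right _ Nat.lt_two_pow_self.le
      _ = 2 ^ (h + h) := (pow_add _ _ _).symm
      _ ≤ 2 ^ Nat.log 2 Y := Nat.pow_le_pow_right (by norm_num) (by omega)
      _ ≤ Y := Nat.pow_log_le_self 2 hY
  have hl : Nat.log 2 Y + 1 ≤ 2 * h + 2 := by omega
  set f := (primesOneMod k Y).card
  set c := (primesOneMod k (2 ^ h)).card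
  set N := Y / 2 ^ k
  calc f * (Nat.log 2 Y + 1) * 2 ^ k ≤ f * (2 * h + 2) * 2 ^ k := by gcongr
    _ = 2 * 2 ^ k * h * f + 2 * (f * 2 ^ k) := by ring
    _ ≤ 2 * 2 ^ k * h * (T.card + c) + 2 * Y := by gcongr
    _ = 2 * 2 ^ k * (h * T.card) + 2 * (h * (c * 2 ^ k)) + 2 * Y := by ring
    _ ≤ 2 * 2 ^ k * (2 * (k + 2) * N) + 2 * (h * 2 ^ h) + 2 * Y := by gcongr
    _ = 4 * (k + 2) * (2 ^ k * N) + 2 * (h * 2 ^ h) + 2 * Y := by ring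
    _ ≤ 4 * (k + 2) * Y + 2 * Y + 2 * Y := by gcongr
    _ ≤ 8 * (k + 2) * Y := by nlinarith

theorem jacobiSym_three_fermatNumber {n : ℕ} (hn : 1 ≤ n) :
    jacobiSym (3 : ℕ) (Nat.fermatNumber n) = -1 := by
  have h4 : Nat.fermatNumber n % 4 = 1 := by
    have : 4 ∣ 2 ^ 2 ^ n := by
      rw [show 4 = 2 ^ 2 from rfl]
      exact pow_dvd_pow _ (Nat.le_self_pow (by omega) 2)
    rw [Nat.fermatNumber]; omega
  have h3 : Nat.fermatNumber n % 3 = 2 := by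
    obtain ⟨m, rfl⟩ := Nat.exists_eq_add_of_le' hn
    rw [Nat.fermatNumber, pow_succ, mul_comm, pow_mul, Nat.add_mod, Nat.pow_mod]
    simp
  rw [jacobiSym.quadratic_reciprocity_one_mod_four' (by decide) h4, jacobiSym.mod_left,
    show ((Nat.fermatNumber n : ℤ) % (3 : ℕ)) = 2 by omega]
  norm_num

theorem jacobiSym_two_fermatNumber {n : ℕ} (hn : 2 ≤ n) :
    jacobiSym (2 : ℕ) (Nat.fermatNumber n) = 1 := by
  have h8 : Nat.fermatNumber n % 8 = 1 := by
    have : 8 ∣ 2 ^ 2 ^ n := by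
      rw [show 8 = 2 ^ 3 from rfl]
      refine pow_dvd_pow _ ?_
      calc 3 ≤ 2 ^ 2 := by norm_num
        _ ≤ 2 ^ n := Nat.pow_le_pow_right (by norm_num) hn
    rw [Nat.fermatNumber]; omega
  rw [Nat.cast_ofNat, jacobiSym.at_two (Nat.odd_fermatNumber n), ← ZMod.natCast_mod, h8]
  decide

theorem fermatNumber_modEq_add_totient {p k n : ℕ} (hp : p.Prime) (hp2 : p ≠ 2)
    (hk : ¬ 2 ^ (k + 1) ∣ p - 1) (hn : k ≤ n) (j : ℕ) :
    Nat.fermatNumber (n + (ordCompl[2] (p - 1)).totient * j) ≡ Nat.fermatNumber n [MOD p] := by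
  have h2 := hp.two_le
  have hp1 : p - 1 ≠ 0 := by omega
  set r := ordCompl[2] (p - 1)
  set v := (p - 1).factorization 2
  have hv : v ≤ k := by
    by_contra! h
    exact hk ((Nat.pow_dvd_pow 2 h).trans (Nat.ordProj_dvd _ _))
  have hvr : 2 ^ v * r = p - 1 := Nat.ordProj_mul_ordCompl_eq_self _ _
  have hr : Nat.Coprime 2 r := Nat.coprime_ordCompl Nat.prime_two hp1
  have hmod : 2 ^ (n + r.totient * j) ≡ 2 ^ n [MOD p - 1] := by
    rw [← hvr, ← Nat.modEq_and_modEq_iff_modEq_mul (hr.pow_left v)]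
    constructor
    · have h1 : 2 ^ v ∣ 2 ^ n := pow_dvd_pow _ (hv.trans hn)
      have h3 : 2 ^ v ∣ 2 ^ (n + r.totient * j) := pow_dvd_pow _ (by omega)
      exact ((Nat.modEq_zero_iff_dvd).2 h3).trans ((Nat.modEq_zero_iff_dvd).2 h1).symm
    · have := ((Nat.ModEq.pow_totient hr).pow j).mul_left (2 ^ n)
      rwa [one_pow, mul_one, ← pow_mul, ← pow_add] at this
  have hcop : Nat.Coprime 2 p := (Nat.coprime_primes Nat.prime_two hp).2 (Ne.symm hp2)
  have hpow : ∀ a b : ℕ, a ≤ b → a ≡ b [MOD p - 1] → 2 ^ b ≡ 2 ^ a [MOD p] := by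
    intro a b hab h
    obtain ⟨c, hc⟩ := (Nat.modEq_iff_dvd' hab).1 h
    have := ((Nat.ModEq.pow_totient hcop).pow c).mul_left (2 ^ a)
    rwa [one_pow, mul_one, ← pow_mul, ← pow_add, Nat.totient_prime hp, ← hc,
      Nat.add_sub_cancel' hab] at this
  exact (hpow _ _ (Nat.pow_le_pow_right (by norm_num) (Nat.le_add_right _ _)) hmod.symm).add_right 1

/-- If no prime factor of `A` is `1` modulo `2 ^ (k + 1)`, then `n ↦ (A / F_n)` is periodic
from `n = k + 2` on. -/
theorem exists_period_jacobiSym_fermatNumber {k A : ℕ} (hA : A ≠ 0)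
    (hk : ∀ p, p.Prime → p ∣ A → ¬ 2 ^ (k + 1) ∣ p - 1) :
    ∃ T, 0 < T ∧ ∀ n, k + 2 ≤ n → ∀ j,
      jacobiSym A (Nat.fermatNumber (n + T * j)) = jacobiSym A (Nat.fermatNumber n) := by
  induction A using Nat.recOnMul with
  | zero => exact absurd rfl hA
  | one => exact ⟨1, one_pos, fun n _ j => by simp⟩
  | prime p hp =>
    rcases eq_or_ne p 2 with rfl | hp2
    · exact ⟨1, one_pos, fun n hn j => by
        rw [jacobiSym_two_fermatNumber (by omega), jacobiSym_two_fermatNumber (by omega)]⟩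
    refine ⟨(ordCompl[2] (p - 1)).totient, ?_, fun n hn j => ?_⟩
    · exact Nat.totient_pos.2 (Nat.ordCompl_pos 2 (by have := hp.two_le; omega))
    · have h4 : ∀ m, 2 ≤ m → Nat.fermatNumber m % 4 = 1 := fun m hm => by
        have : 4 ∣ 2 ^ 2 ^ m := by
          rw [show 4 = 2 ^ 2 from rfl]
          exact pow_dvd_pow _ (Nat.le_self_pow (by omega) 2)
        rw [Nat.fermatNumber]; omega
      have hodd : Odd p := hp.odd_of_ne_two hp2
      rw [jacobiSym.quadratic_reciprocity_one_mod_four' hodd (h4 _ (by omega)),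
        jacobiSym.quadratic_reciprocity_one_mod_four' hodd (h4 _ (by omega))]
      refine jacobiSym.mod_left' ?_
      exact_mod_cast fermatNumber_modEq_add_totient hp hp2 (hk p hp dvd_rfl)
        (show k ≤ n by omega) j
  | mul a b iha ihb =>
    obtain ⟨S, hS, hSp⟩ := iha (by rintro rfl; simp at hA) fun p hp h => hk p hp (h.mul_right b)
    obtain ⟨T, hT, hTp⟩ := ihb (by rintro rfl; simp at hA) fun p hp h => hk p hp (h.mul_left a)
    refine ⟨S * T, Nat.mul_pos hS hT, fun n hn j => ?_⟩
    rw [Nat.cast_mul, jacobiSym.mul_left, jacobiSym.mul_left, mul_assoc, hSp n hn, ← mul_assoc,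
      mul_comm S T, mul_assoc, hTp n hn]

theorem jacobiSym_fermatNumber_eq_one_of_eventually {k A : ℕ} (hA : A ≠ 0)
    (hk : ∀ p, p.Prime → p ∣ A → ¬ 2 ^ (k + 1) ∣ p - 1)
    (h : ∀ᶠ n : ℕ in Filter.atTop, jacobiSym A (Nat.fermatNumber n) = 1) {n : ℕ}
    (hn : k + 2 ≤ n) : jacobiSym A (Nat.fermatNumber n) = 1 := by
  obtain ⟨T, hT, hp⟩ := exists_period_jacobiSym_fermatNumber hA hk
  obtain ⟨N, hN⟩ := Filter.eventually_atTop.1 h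
  rw [← hp n hn N]
  exact hN _ ((Nat.le_mul_of_pos_left N hT).trans (Nat.le_add_left _ _))

/-- Each nonzero value of a Jacobi symbol `(· / b)` taking the value `-1` occurs on at most half of
the residues. -/
theorem two_mul_card_jacobiSym_eq_le {b g : ℕ} (hg : jacobiSym g b = -1) {s : ℤ} (hs : s ≠ 0) :
    2 * ((Finset.range b).filter fun a : ℕ => jacobiSym a b = s).card ≤ b := by
  have hb : 0 < b := Nat.pos_of_ne_zero fun h => by simp [h] at hg
  set S := (Finset.range b).filter fun a : ℕ => jacobiSym a b = s
  set S' := (Finset.range b).filter fun a : ℕ => jacobiSym a b = -s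
  have hgb : Nat.Coprime b g := by
    have : jacobiSym g b ≠ 0 := by rw [hg]; decide
    rw [Ne, jacobiSym.eq_zero_iff] at this
    have := not_and_not_right.1 this hb.ne'
    rw [Int.gcd_natCast_natCast] at this
    exact (Nat.Coprime.symm this)
  have hmap : S.card ≤ S'.card := by
    refine Finset.card_le_card_of_injOn (fun a => g * a % b) (fun a ha => ?_) fun x hx y hy h => ?_
    · have ha' := (Finset.mem_filter.1 ha).2
      refine Finset.mem_filter.2 ⟨Finset.mem_range.2 (Nat.mod_lt _ hb), ?_⟩
      rw [Int.natCast_mod, ← jacobiSym.mod_left, Nat.cast_mul, jacobiSym.mul_left, hg, ha']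
      ring
    · have hx' := Finset.mem_range.1 (Finset.mem_filter.1 hx).1
      have hy' := Finset.mem_range.1 (Finset.mem_filter.1 hy).1
      exact (Nat.ModEq.cancel_left_of_coprime hgb h).eq_of_lt_of_lt hx' hy'
  have hdisj : Disjoint S S' := by
    refine Finset.disjoint_filter.2 fun a _ h h' => hs ?_
    rw [h] at h'; omega
  have hsub : S ∪ S' ⊆ Finset.range b :=
    Finset.union_subset (Finset.filter_subset _ _) (Finset.filter_subset _ _)
  have := Finset.card_le_card hsub
  rw [Finset.card_union_of_disjoint hdisj, Finset.card_range] at this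
  omega

theorem two_pow_mul_card_jacobiSym_fermatNumber_le {I : Finset ℕ} (hI : ∀ n ∈ I, 1 ≤ n)
    {s : ℕ → ℤ} (hs : ∀ n ∈ I, s n ≠ 0) :
    2 ^ I.card * ((Finset.range (∏ n ∈ I, Nat.fermatNumber n)).filter fun a : ℕ =>
      ∀ n ∈ I, jacobiSym a (Nat.fermatNumber n) = s n).card ≤ ∏ n ∈ I, Nat.fermatNumber n := by
  induction I using Finset.induction_on with
  | empty => simp
  | insert i I hi ih =>
    have ih := ih (fun n hn => hI n (Finset.mem_insert_of_mem hn))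
      fun n hn => hs n (Finset.mem_insert_of_mem hn)
    have h1 := two_mul_card_jacobiSym_eq_le
      (jacobiSym_three_fermatNumber (hI i (Finset.mem_insert_self _ _)))
      (hs i (Finset.mem_insert_self _ _))
    have hcop : (Nat.fermatNumber i).Coprime (∏ n ∈ I, Nat.fermatNumber n) :=
      Nat.Coprime.prod_right fun n hn =>
        Nat.coprime_fermatNumber_fermatNumber (by rintro rfl; exact hi hn)
    have hq : 0 < ∏ n ∈ I, Nat.fermatNumber n := Finset.prod_pos fun n _ => Nat.succ_pos _
    rw [Finset.card_insert_of_notMem hi, Finset.prod_insert hi]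
    set q := ∏ n ∈ I, Nat.fermatNumber n with hqdef
    set U := (Finset.range (Nat.fermatNumber i)).filter fun a : ℕ =>
      jacobiSym a (Nat.fermatNumber i) = s i
    set V := (Finset.range q).filter fun a : ℕ =>
      ∀ n ∈ I, jacobiSym a (Nat.fermatNumber n) = s n
    set W := (Finset.range (Nat.fermatNumber i * q)).filter fun a : ℕ =>
      ∀ n ∈ insert i I, jacobiSym a (Nat.fermatNumber n) = s n
    have hW : W.card ≤ (U ×ˢ V).card := by
      refine Finset.card_le_card_of_injOn (fun a => (a % Nat.fermatNumber i, a % q))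
        (fun a ha => ?_) fun x hx y hy h => ?_
      · have ha' := (Finset.mem_filter.1 ha).2
        refine Finset.mem_product.2 ⟨Finset.mem_filter.2
          ⟨Finset.mem_range.2 (Nat.mod_lt _ (Nat.succ_pos _)), ?_⟩, Finset.mem_filter.2
          ⟨Finset.mem_range.2 (Nat.mod_lt _ hq), fun n hn => ?_⟩⟩
        · rw [Int.natCast_mod, ← jacobiSym.mod_left]
          exact ha' i (Finset.mem_insert_self _ _)
        · rw [← ha' n (Finset.mem_insert_of_mem hn)]
          refine jacobiSym.mod_left' ?_
          exact_mod_cast (Nat.mod_modEq a q).of_dvd (Finset.dvd_prod_of_mem _ hn)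
      · have hx' := Finset.mem_range.1 (Finset.mem_filter.1 hx).1
        have hy' := Finset.mem_range.1 (Finset.mem_filter.1 hy).1
        obtain ⟨h2, h3⟩ := Prod.ext_iff.1 h
        exact ((Nat.modEq_and_modEq_iff_modEq_mul hcop).1 ⟨h2, h3⟩).eq_of_lt_of_lt hx' hy'
    rw [Finset.card_product] at hW
    calc 2 ^ (I.card + 1) * W.card ≤ 2 ^ (I.card + 1) * (U.card * V.card) := by gcongr
      _ = (2 * U.card) * (2 ^ I.card * V.card) := by ring
      _ ≤ _ := Nat.mul_le_mul h1 ih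

theorem prod_Ico_fermatNumber_lt (a b : ℕ) :
    ∏ n ∈ Finset.Ico a b, Nat.fermatNumber n < 2 ^ 2 ^ b := by
  have h := Nat.prod_fermatNumber b
  have h3 := Nat.three_le_fermatNumber b
  have hle : ∏ n ∈ Finset.Ico a b, Nat.fermatNumber n ≤ ∏ n ∈ Finset.range b, Nat.fermatNumber n :=
    Finset.prod_le_prod_of_subset_of_one_le'
      (fun n hn => Finset.mem_range.2 (Finset.mem_Ico.1 hn).2) fun n _ _ => Nat.succ_pos _
  rw [Nat.fermatNumber] at h h3
  omega

theorem card_jacobiSym_fermatNumber_mul_le (k N : ℕ) {s : ℕ → ℤ} (hs : ∀ n, k + 2 ≤ n → s n ≠ 0)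
    {B : Finset ℕ} (hBI : B ⊆ Finset.Icc 1 N)
    (hBs : ∀ m ∈ B, ∀ n, k + 2 ≤ n → jacobiSym (m : ℕ) (Nat.fermatNumber n) = s n) :
    B.card * (Nat.log 2 N + 1) ≤ 16 * 2 ^ k * N := by
  have hBN : B.card ≤ N := (Finset.card_le_card hBI).trans (by simp)
  rcases eq_or_ne N 0 with rfl | hN
  · simp_all
  set l := Nat.log 2 N
  rcases lt_or_ge l (2 ^ (k + 2)) with hl | hl
  · calc B.card * (l + 1) ≤ N * 2 ^ (k + 2) := Nat.mul_le_mul hBN hl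
      _ ≤ 16 * 2 ^ k * N := by rw [pow_add]; linarith [Nat.zero_le (2 ^ k * N)]
  have hl0 : l ≠ 0 := by have := Nat.pos_of_ne_zero (pow_ne_zero (k + 2) two_ne_zero); omega
  set t := Nat.log 2 l
  have ht : 2 ^ t ≤ l := Nat.pow_log_le_self 2 hl0
  have ht' : l < 2 ^ (t + 1) := Nat.lt_pow_succ_log_self (by norm_num) l
  have hkt : k + 2 ≤ t := Nat.le_log_of_pow_le (by norm_num) hl
  set I := Finset.Ico (k + 2) t
  set q := ∏ n ∈ I, Nat.fermatNumber n
  have hq0 : 0 < q := Finset.prod_pos fun n _ => Nat.succ_pos _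
  have hqN : q ≤ N := by
    calc q ≤ 2 ^ 2 ^ t := (prod_Ico_fermatNumber_lt _ _).le
      _ ≤ 2 ^ l := Nat.pow_le_pow_right (by norm_num) ht
      _ ≤ N := Nat.pow_log_le_self 2 hN
  set V := (Finset.range q).filter fun a : ℕ =>
      ∀ n ∈ I, jacobiSym a (Nat.fermatNumber n) = s n
  have hV : 2 ^ I.card * V.card ≤ q :=
    two_pow_mul_card_jacobiSym_fermatNumber_le
      (fun n hn => by have := (Finset.mem_Ico.1 hn).1; omega) fun n hn => hs n (Finset.mem_Ico.1 hn).1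
  have hB : B.card ≤ (Finset.range (N / q + 1) ×ˢ V).card := by
    refine Finset.card_le_card_of_injOn (fun a => (a / q, a % q)) (fun a ha => ?_)
      fun x _ y _ h => ?_
    · have ha' := hBs a ha
      refine Finset.mem_product.2 ⟨Finset.mem_range.2
        (Nat.lt_succ_of_le (Nat.div_le_div_right (Finset.mem_Icc.1 (hBI ha)).2)),
        Finset.mem_filter.2 ⟨Finset.mem_range.2 (Nat.mod_lt _ hq0), fun n hn => ?_⟩⟩
      rw [← ha' n (Finset.mem_Ico.1 hn).1]
      refine jacobiSym.mod_left' ?_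
      exact_mod_cast (Nat.mod_modEq a q).of_dvd (Finset.dvd_prod_of_mem _ hn)
    · obtain ⟨h1, h2⟩ := Prod.ext_iff.1 h
      rw [← Nat.div_add_mod x q, ← Nat.div_add_mod y q]
      simp only at h1 h2
      rw [h1, h2]
  rw [Finset.card_product, Finset.card_range] at hB
  have hNq : (N / q + 1) * q ≤ 2 * N := by
    have := Nat.div_mul_le_self N q
    linarith
  have hI : 2 ^ (t + 1) = 8 * 2 ^ k * 2 ^ I.card := by
    rw [Nat.card_Ico, show t + 1 = 3 + k + (t - (k + 2)) by omega, pow_add, pow_add]; norm_num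
  calc B.card * (l + 1) ≤ ((N / q + 1) * V.card) * (8 * 2 ^ k * 2 ^ I.card) := by
        rw [← hI]; exact Nat.mul_le_mul hB ht'
    _ = 8 * 2 ^ k * ((N / q + 1) * (2 ^ I.card * V.card)) := by ring
    _ ≤ 8 * 2 ^ k * ((N / q + 1) * q) := by gcongr
    _ ≤ 8 * 2 ^ k * (2 * N) := by gcongr
    _ = 16 * 2 ^ k * N := by ring

theorem card_jacobiSym_mul_eq_one_mul_le (k N p : ℕ) {B : Finset ℕ} (hBI : B ⊆ Finset.Icc 1 N)
    (hB : ∀ m ∈ B, ∀ n, k + 2 ≤ n →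
      jacobiSym ((p * m : ℕ) : ℤ) (Nat.fermatNumber n) = 1) :
    B.card * (Nat.log 2 N + 1) ≤ 16 * 2 ^ k * N := by
  rcases B.eq_empty_or_nonempty with rfl | ⟨m₀, hm₀⟩
  · simp
  have hunit : ∀ m ∈ B, ∀ n, k + 2 ≤ n →
      jacobiSym p (Nat.fermatNumber n) * jacobiSym m (Nat.fermatNumber n) = 1 := fun m hm n hn => by
    rw [← jacobiSym.mul_left, ← Nat.cast_mul]
    exact hB m hm n hn
  refine card_jacobiSym_fermatNumber_mul_le k N (s := fun n => jacobiSym p (Nat.fermatNumber n))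
    (fun n hn h => ?_) hBI fun m hm n hn => ?_
  · have := hunit m₀ hm₀ n hn
    rw [h, zero_mul] at this
    exact zero_ne_one this
  · rcases Int.mul_eq_one_iff_eq_one_or_neg_one.1 (hunit m hm n hn) with ⟨h, h'⟩ | ⟨h, h'⟩ <;>
      rw [h, h']

theorem sum_primesOneMod_le (k X : ℕ) {w : ℕ → ℝ} (hw : ∀ i, 0 ≤ w i) :
    ∑ p ∈ primesOneMod k X, ((X / p : ℕ) : ℝ) * w (Nat.log 2 (X / p)) ≤
      16 * (k + 2) * X / 2 ^ k *
        ∑ i ∈ Finset.range (Nat.log 2 X + 1), w i / ((Nat.log 2 X - i : ℕ) + 1) := by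
  set l := Nat.log 2 X
  have hmaps : ∀ p ∈ primesOneMod k X, Nat.log 2 (X / p) ∈ Finset.range (l + 1) := fun p _ =>
    Finset.mem_range.2 (Nat.lt_succ_of_le (Nat.log_mono_right (Nat.div_le_self _ _)))
  rw [← Finset.sum_fiberwise_of_maps_to hmaps, Finset.mul_sum]
  refine Finset.sum_le_sum fun i hi => ?_
  have hterm : ∀ p ∈ (primesOneMod k X).filter (fun p => Nat.log 2 (X / p) = i),
      ((X / p : ℕ) : ℝ) * w (Nat.log 2 (X / p)) ≤ 2 ^ (i + 1) * w i := fun p hp => by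
    have h := (Finset.mem_filter.1 hp).2
    rw [h]
    refine mul_le_mul_of_nonneg_right ?_ (hw i)
    have : X / p < 2 ^ (i + 1) := h ▸ Nat.lt_pow_succ_log_self (by norm_num) _
    exact_mod_cast this.le
  have hcard : ((primesOneMod k X).filter fun p => Nat.log 2 (X / p) = i).card ≤
      (primesOneMod k (X / 2 ^ i)).card := by
    refine Finset.card_le_card fun p hp => ?_
    obtain ⟨hp, h⟩ := Finset.mem_filter.1 hp
    obtain ⟨hpX, hp'⟩ := mem_primesOneMod.1 hp
    refine mem_primesOneMod.2 ⟨?_, hp'⟩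
    have hXp : X / p ≠ 0 := (Nat.div_pos hpX hp'.1.pos).ne'
    have h1 : 2 ^ i ≤ X / p := h ▸ Nat.pow_log_le_self 2 hXp
    rw [Nat.le_div_iff_mul_le hp'.1.pos] at h1
    rwa [Nat.le_div_iff_mul_le (by positivity), mul_comm]
  have hf := card_primesOneMod_mul_log_le k (X / 2 ^ i)
  rw [Nat.log_div_base_pow] at hf
  have hY : X / 2 ^ i * 2 ^ i ≤ X := Nat.div_mul_le_self _ _
  set f := (primesOneMod k (X / 2 ^ i)).card
  have hf' : (f : ℝ) * ((l - i : ℕ) + 1) * 2 ^ k * 2 ^ i ≤ 8 * (k + 2) * X := by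
    have : f * ((l - i) + 1) * 2 ^ k * 2 ^ i ≤ 8 * (k + 2) * X :=
      calc _ ≤ 8 * (k + 2) * (X / 2 ^ i) * 2 ^ i := Nat.mul_le_mul_right _ hf
        _ = 8 * (k + 2) * (X / 2 ^ i * 2 ^ i) := by ring
        _ ≤ _ := by gcongr
    exact_mod_cast this
  have hd : (0 : ℝ) < (l - i : ℕ) + 1 := by positivity
  calc _ ≤ (((primesOneMod k X).filter fun p => Nat.log 2 (X / p) = i).card : ℝ) *
        (2 ^ (i + 1) * w i) := by
        rw [← nsmul_eq_mul]; exact Finset.sum_le_card_nsmul _ _ _ hterm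
    _ ≤ f * (2 ^ (i + 1) * w i) := by
        refine mul_le_mul_of_nonneg_right (by exact_mod_cast hcard) ?_
        have := hw i
        positivity
    _ = (f * ((l - i : ℕ) + 1) * 2 ^ k * 2 ^ i) * (2 * w i / (2 ^ k * ((l - i : ℕ) + 1))) := by
        field_simp; ring
    _ ≤ (8 * (k + 2) * X) * (2 * w i / (2 ^ k * ((l - i : ℕ) + 1))) := by
        have := hw i
        gcongr
    _ = _ := by field_simp; ring

/-- If each `A ∈ s` has a prime factor `p ≡ 1 [MOD 2 ^ k]`, count `s` by the cofactors `A / p`. -/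
theorem card_le_sum_primesOneMod {k X : ℕ} {s : Finset ℕ} (hs : s ⊆ Finset.Icc 1 X)
    (hsk : ∀ A ∈ s, ∃ p, p.Prime ∧ p ∣ A ∧ 2 ^ k ∣ p - 1) :
    s.card ≤ ∑ p ∈ primesOneMod k X, ((Finset.Icc 1 (X / p)).filter fun m => p * m ∈ s).card := by
  refine le_trans (Finset.card_le_card (t := (primesOneMod k X).biUnion fun p =>
    ((Finset.Icc 1 (X / p)).filter fun m => p * m ∈ s).image (p * ·)) fun A hA => ?_)
    (Finset.card_biUnion_le.trans (Finset.sum_le_sum fun p _ => Finset.card_image_le))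
  obtain ⟨p, hp, ⟨m, rfl⟩, hpk⟩ := hsk A hA
  obtain ⟨h1, hX⟩ := Finset.mem_Icc.1 (hs hA)
  have hm : 0 < m := Nat.pos_of_mul_pos_left h1
  refine Finset.mem_biUnion.2 ⟨p, mem_primesOneMod.2
    ⟨(Nat.le_mul_of_pos_right p hm).trans hX, hp, hpk⟩, Finset.mem_image.2 ⟨m, ?_, rfl⟩⟩
  refine Finset.mem_filter.2 ⟨Finset.mem_Icc.2 ⟨hm, ?_⟩, hA⟩
  rw [Nat.le_div_iff_mul_le hp.pos, mul_comm]
  exact hX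

theorem sum_inv_mul_inv_reflect_le (l : ℕ) :
    ∑ i ∈ Finset.range (l + 1), (1 / ((i : ℝ) + 1)) / ((l - i : ℕ) + 1) ≤
      2 * (∑ i ∈ Finset.range (l + 1), 1 / ((i : ℝ) + 1)) / (l + 1) := by
  have hrefl := Finset.sum_range_reflect (fun i : ℕ => 1 / ((i : ℝ) + 1)) (l + 1)
  have hsum : 2 * (∑ i ∈ Finset.range (l + 1), 1 / ((i : ℝ) + 1)) / (l + 1) =
      ∑ i ∈ Finset.range (l + 1), (1 / ((i : ℝ) + 1) + 1 / ((l - i : ℕ) + 1)) / (l + 1) := by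
    rw [← Finset.sum_div, Finset.sum_add_distrib, two_mul]
    congr 2
    rw [← hrefl]
    simp
  rw [hsum]
  refine Finset.sum_le_sum fun i hi => ?_
  have hi' : i ≤ l := Nat.lt_succ_iff.1 (Finset.mem_range.1 hi)
  rw [Nat.cast_sub hi']
  have h : (0 : ℝ) < l - i + 1 := by
    have : (i : ℝ) ≤ l := by exact_mod_cast hi'
    linarith
  have h0 : (0 : ℝ) < i + 1 := by positivity
  rw [div_add_div _ _ h0.ne' h.ne', div_div, div_div, div_le_div_iff₀ (by positivity) (by positivity)]
  have : 0 < ((i : ℝ) + 1) * (l - i + 1) := by positivity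
  nlinarith

theorem sum_one_div_le (l : ℕ) :
    ∑ i ∈ Finset.range (l + 1), 1 / ((i : ℝ) + 1) ≤ 1 + Real.log (l + 1) := by
  have := harmonic_le_one_add_log (l + 1)
  simpa [harmonic] using this

/-- The bound for those `A` with a prime factor `p ≡ 1 [MOD 2 ^ k]` and `(A / F_n) = 1` for all
`n ≥ k + 2`. -/
theorem card_le_of_jacobiSym_fermatNumber_eq_one {k X : ℕ} {s : Finset ℕ} (hs : s ⊆ Finset.Icc 1 X)
    (hsk : ∀ A ∈ s, ∃ p, p.Prime ∧ p ∣ A ∧ 2 ^ k ∣ p - 1)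
    (hs1 : ∀ A ∈ s, ∀ n, k + 2 ≤ n → jacobiSym (A : ℕ) (Nat.fermatNumber n) = 1) :
    (s.card : ℝ) ≤ 512 * (k + 2) * X * (1 + Real.log (Nat.log 2 X + 1)) / (Nat.log 2 X + 1) := by
  set l := Nat.log 2 X
  set w : ℕ → ℝ := fun i => 16 * 2 ^ k * (1 / ((i : ℝ) + 1))
  calc (s.card : ℝ) ≤ ∑ p ∈ primesOneMod k X,
        (((Finset.Icc 1 (X / p)).filter fun m => p * m ∈ s).card : ℝ) := by
        exact_mod_cast card_le_sum_primesOneMod hs hsk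
    _ ≤ ∑ p ∈ primesOneMod k X, ((X / p : ℕ) : ℝ) * w (Nat.log 2 (X / p)) := by
        refine Finset.sum_le_sum fun p _ => ?_
        have := card_jacobiSym_mul_eq_one_mul_le k (X / p) p
          (B := (Finset.Icc 1 (X / p)).filter fun m => p * m ∈ s) (Finset.filter_subset _ _)
          fun m hm => hs1 _ (Finset.mem_filter.1 hm).2
        have hr : (((Finset.Icc 1 (X / p)).filter fun m => p * m ∈ s).card : ℝ) *
          (Nat.log 2 (X / p) + 1) ≤ 16 * 2 ^ k * (X / p : ℕ) := by exact_mod_cast this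
        rw [← le_div_iff₀ (by positivity)] at hr
        refine hr.trans_eq ?_
        simp only [w]
        ring
    _ ≤ _ := sum_primesOneMod_le k X fun i => by positivity
    _ = 256 * (k + 2) * X *
        ∑ i ∈ Finset.range (l + 1), (1 / ((i : ℝ) + 1)) / ((l - i : ℕ) + 1) := by
        simp only [w, mul_div_assoc, ← Finset.mul_sum]
        field_simp
        ring
    _ ≤ 256 * (k + 2) * X * (2 * (1 + Real.log (l + 1)) / (l + 1)) := by
        gcongr
        refine (sum_inv_mul_inv_reflect_le l).trans ?_
        gcongr
        exact sum_one_div_le l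
    _ = _ := by ring

theorem card_exists_prime_dvd_le {k X : ℕ} {s : Finset ℕ} (hs : s ⊆ Finset.Icc 1 X)
    (hsk : ∀ A ∈ s, ∃ p, p.Prime ∧ p ∣ A ∧ 2 ^ k ∣ p - 1) :
    (s.card : ℝ) ≤ 16 * (k + 2) * X / 2 ^ k * (1 + Real.log (Nat.log 2 X + 1)) := by
  set l := Nat.log 2 X
  calc (s.card : ℝ) ≤ ∑ p ∈ primesOneMod k X,
        (((Finset.Icc 1 (X / p)).filter fun m => p * m ∈ s).card : ℝ) := by
        exact_mod_cast card_le_sum_primesOneMod hs hsk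
    _ ≤ ∑ p ∈ primesOneMod k X, ((X / p : ℕ) : ℝ) * (fun _ => 1) (Nat.log 2 (X / p)) := by
        refine Finset.sum_le_sum fun p _ => ?_
        rw [mul_one]
        exact_mod_cast (Finset.card_filter_le _ _).trans (by simp)
    _ ≤ _ := sum_primesOneMod_le k X fun _ => zero_le_one
    _ ≤ _ := by
        gcongr
        refine le_trans (le_of_eq ?_) (sum_one_div_le l)
        rw [← Finset.sum_range_reflect (fun i : ℕ => 1 / ((i : ℝ) + 1)) (l + 1)]
        simp [l]

theorem card_antielite_le {X : ℕ} {s : Finset ℕ} (hs : s ⊆ Finset.Icc 2 X)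
    (hs1 : ∀ A ∈ s, ∀ᶠ n : ℕ in Filter.atTop, jacobiSym (A : ℕ) (Nat.fermatNumber n) = 1) :
    (s.card : ℝ) ≤ 3072 * X * (1 + 2 * Real.log (Nat.log 2 X + 1)) ^ 3 / (Nat.log 2 X + 1) := by
  classical
  set l := Nat.log 2 X
  set K := Nat.log 2 (l + 1) + 1
  have hlK : l + 1 < 2 ^ K := Nat.lt_pow_succ_log_self (by norm_num) _
  have hs' : s ⊆ Finset.Icc 1 X := hs.trans (Finset.Icc_subset_Icc_left (by norm_num))
  set D : ℕ → Finset ℕ := fun k => s.filter fun A =>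
    (∃ p, p.Prime ∧ p ∣ A ∧ 2 ^ k ∣ p - 1) ∧ ∀ p, p.Prime → p ∣ A → ¬ 2 ^ (k + 1) ∣ p - 1
  set E := s.filter fun A => ∃ p, p.Prime ∧ p ∣ A ∧ 2 ^ K ∣ p - 1
  have hcover : s ⊆ (Finset.range K).biUnion D ∪ E := by
    intro A hA
    by_cases hE : ∃ p, p.Prime ∧ p ∣ A ∧ 2 ^ K ∣ p - 1
    · exact Finset.mem_union_right _ (Finset.mem_filter.2 ⟨hA, hE⟩)
    have hex : ∃ k, ¬ ∃ p, p.Prime ∧ p ∣ A ∧ 2 ^ k ∣ p - 1 := ⟨K, hE⟩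
    obtain ⟨j, hj⟩ : ∃ j, Nat.find hex = j + 1 := by
      refine Nat.exists_eq_succ_of_ne_zero fun h => ?_
      have h2 := (Finset.mem_Icc.1 (hs hA)).1
      obtain ⟨p, hp, hpA⟩ := Nat.exists_prime_and_dvd (n := A) (by omega)
      exact (Nat.find_eq_zero hex).1 h ⟨p, hp, hpA, by simp⟩
    have hjK : j + 1 ≤ K := hj ▸ Nat.find_min' hex hE
    refine Finset.mem_union_left _ (Finset.mem_biUnion.2 ⟨j, Finset.mem_range.2 hjK,
      Finset.mem_filter.2 ⟨hA, ?_, fun p hp hpA h => ?_⟩⟩)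
    · exact not_not.1 (Nat.find_min hex (hj ▸ Nat.lt_succ_self j))
    · exact (hj ▸ Nat.find_spec hex) ⟨p, hp, hpA, h⟩
  set u := 1 + 2 * Real.log (l + 1)
  have hlog : 0 ≤ Real.log ((l : ℝ) + 1) := Real.log_nonneg (by simp)
  have hu : 1 ≤ u := by simp only [u]; linarith
  have hHu : 1 + Real.log ((l : ℝ) + 1) ≤ u := by simp only [u]; linarith
  have hKu : (K : ℝ) ≤ u := by
    have h1 : ((2 ^ Nat.log 2 (l + 1) : ℕ) : ℝ) ≤ ((l + 1 : ℕ) : ℝ) := by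
      exact_mod_cast Nat.pow_log_le_self 2 (by omega)
    have h2 := Real.log_le_log (by positivity) h1
    push_cast at h2
    rw [Real.log_pow] at h2
    have h3 := Real.log_two_gt_d9
    have h4 : (0 : ℝ) ≤ Nat.log 2 (l + 1) := by positivity
    simp only [K, u]
    push_cast
    nlinarith
  have hl : (0 : ℝ) < l + 1 := by positivity
  have hD : ∀ k ∈ Finset.range K, ((D k).card : ℝ) ≤ 512 * (u + 2) * X * u / (l + 1) := by
    intro k hk
    have hku : (k : ℝ) ≤ u := le_trans (by exact_mod_cast (Finset.mem_range.1 hk).le) hKu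
    refine (card_le_of_jacobiSym_fermatNumber_eq_one ((Finset.filter_subset _ _).trans hs')
      (fun A hA => (Finset.mem_filter.1 hA).2.1) fun A hA n hn => ?_).trans (by gcongr)
    obtain ⟨hA, -, hk⟩ := Finset.mem_filter.1 hA
    have hA0 : A ≠ 0 := by have := (Finset.mem_Icc.1 (hs hA)).1; omega
    exact jacobiSym_fermatNumber_eq_one_of_eventually hA0 hk (hs1 A hA) hn
  have hE : (E.card : ℝ) ≤ 512 * (u + 2) * X * u / (l + 1) := by
    refine (card_exists_prime_dvd_le ((Finset.filter_subset _ _).trans hs')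
      fun A hA => (Finset.mem_filter.1 hA).2).trans ?_
    have hlK' : (l : ℝ) + 1 ≤ 2 ^ K := by exact_mod_cast hlK.le
    calc 16 * ((K : ℝ) + 2) * X / 2 ^ K * (1 + Real.log (l + 1))
        ≤ 512 * (u + 2) * X / (l + 1) * u := by gcongr; norm_num
      _ = _ := by ring
  have hcard : (s.card : ℝ) ≤ ∑ k ∈ Finset.range K, ((D k).card : ℝ) + E.card := by
    exact_mod_cast (Finset.card_le_card hcover).trans ((Finset.card_union_le _ _).trans
      (Nat.add_le_add_right Finset.card_biUnion_le _))
  calc (s.card : ℝ) ≤ K * (512 * (u + 2) * X * u / (l + 1)) + 512 * (u + 2) * X * u / (l + 1) := by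
        refine hcard.trans (add_le_add ?_ hE)
        have := Finset.sum_le_card_nsmul _ _ _ hD
        rwa [Finset.card_range, nsmul_eq_mul] at this
    _ ≤ u * (512 * (u + 2) * X * u / (l + 1)) + 512 * (u + 2) * X * u / (l + 1) := by
        gcongr
    _ = 512 * X * u * ((u + 1) * (u + 2)) / (l + 1) := by ring
    _ ≤ 512 * X * u * (6 * u ^ 2) / (l + 1) := by
        have : (u + 1) * (u + 2) ≤ 6 * u ^ 2 := by nlinarith
        gcongr
    _ = _ := by ring

theorem one_add_two_mul_log_pow_three_le {δ t : ℝ} (hδ : 0 < δ) (ht : 1 ≤ t) :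
    (1 + 2 * Real.log t) ^ 3 ≤ (1 + 2 / δ) ^ 3 * t ^ (3 * δ) := by
  have h0 : 0 ≤ Real.log t := Real.log_nonneg ht
  have h1 : Real.log t ≤ t ^ δ / δ := Real.log_le_rpow_div (by linarith) hδ
  have h2 : 1 ≤ t ^ δ := Real.one_le_rpow ht hδ.le
  have h3 : t ^ (3 * δ) = (t ^ δ) ^ 3 := by
    rw [← Real.rpow_natCast, ← Real.rpow_mul (by linarith), mul_comm]; norm_num
  rw [h3, ← mul_pow]
  refine pow_le_pow_left₀ (by positivity) ?_ 3
  calc 1 + 2 * Real.log t ≤ t ^ δ + 2 * (t ^ δ / δ) := by linarith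
    _ = _ := by ring

/-- Theorem 3.2: for each `ε > 0` and all `x > x₀(ε)`, the number of anti-elite integers
`A ∈ (1, x]` is `O_ε(x / (log x)^(1-ε))`. Here a positive integer `A` is anti-elite if
the Jacobi symbol `(A / F_n)` equals `1` for all sufficiently large `n`, where
`F_n = 2^(2^n) + 1` is the `n`-th Fermat number. -/
theorem antielite_count (ε : ℝ) (hε : 0 < ε) :
    ∃ C x₀ : ℝ, ∀ x : ℝ, x₀ < x →
      (({A : ℕ | 1 < A ∧ (A : ℝ) ≤ x ∧
        ∀ᶠ n : ℕ in Filter.atTop, jacobiSym (A : ℤ) (2 ^ 2 ^ n + 1) = 1}).ncard : ℝ)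
        ≤ C * x / Real.log x ^ (1 - ε) := by
  set ε' := min ε 1
  have hε' : 0 < ε' := lt_min hε one_pos
  refine ⟨3072 * (1 + 2 / (ε' / 3)) ^ 3, Real.exp 1, fun x hx => ?_⟩
  have hx0 : 0 < x := (Real.exp_pos 1).trans hx
  have hlogx : 1 ≤ Real.log x := (Real.le_log_iff_exp_le hx0).2 hx.le
  set X := ⌊x⌋₊
  have hXx : (X : ℝ) ≤ x := Nat.floor_le hx0.le
  set S := {A : ℕ | 1 < A ∧ (A : ℝ) ≤ x ∧
        ∀ᶠ n : ℕ in Filter.atTop, jacobiSym (A : ℤ) (2 ^ 2 ^ n + 1) = 1}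
  have hSX : S ⊆ Finset.Icc 2 X := fun A hA =>
    Finset.mem_coe.2 (Finset.mem_Icc.2 ⟨hA.1, Nat.le_floor hA.2.1⟩)
  have hfin : S.Finite := (Finset.finite_toSet _).subset hSX
  have hcard := card_antielite_le (X := X) (s := hfin.toFinset)
    (fun A hA => hSX (hfin.mem_toFinset.1 hA)) fun A hA => (hfin.mem_toFinset.1 hA).2.2
  rw [Set.ncard_eq_toFinset_card S hfin]
  set t : ℝ := (Nat.log 2 X : ℝ) + 1 with htdef
  have ht : 1 ≤ t := by simp [t]
  have htx : Real.log x ≤ t := by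
    have h1 : x < ((2 ^ (Nat.log 2 X + 1) : ℕ) : ℝ) := by
      refine (Nat.lt_floor_add_one x).trans_le ?_
      exact_mod_cast Nat.lt_pow_succ_log_self (b := 2) (by norm_num) X
    have h2 := Real.log_le_log hx0 h1.le
    push_cast at h2
    rw [Real.log_pow] at h2
    push_cast at h2
    have h3 := Real.log_two_lt_d9
    nlinarith
  have ht0 : 0 < t := by linarith
  have hmain := one_add_two_mul_log_pow_three_le (δ := ε' / 3) (by positivity) ht
  rw [mul_div_cancel₀ ε' three_ne_zero] at hmain
  calc (hfin.toFinset.card : ℝ) ≤ 3072 * X * (1 + 2 * Real.log t) ^ 3 / t := hcard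
    _ ≤ 3072 * x * ((1 + 2 / (ε' / 3)) ^ 3 * t ^ ε') / t := by
        have hlogt := Real.log_nonneg ht
        gcongr
    _ = 3072 * (1 + 2 / (ε' / 3)) ^ 3 * x / t ^ (1 - ε') := by
        rw [Real.rpow_sub ht0, Real.rpow_one]
        have := Real.rpow_pos_of_pos ht0 ε'
        field_simp
    _ ≤ 3072 * (1 + 2 / (ε' / 3)) ^ 3 * x / Real.log x ^ (1 - ε) := by
        have h1 : Real.log x ^ (1 - ε) ≤ t ^ (1 - ε') :=
          (Real.rpow_le_rpow_of_exponent_le hlogx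
            (sub_le_sub_left (min_le_left ε 1) 1)).trans
            (Real.rpow_le_rpow (by linarith) htx (sub_nonneg.2 (min_le_right ε 1)))
        have h2 : 0 < Real.log x ^ (1 - ε) := Real.rpow_pos_of_pos (by linarith) _
        gcongr
end

section
/- Let A and B be integers larger than 1. Let r₀ be a nonnegative integer such that for every prime p dividing A, the p-adic valuation of A^(r₀) is at least the p-adic valuation of B, and let r be an even integer with r > r₀ + 3. If B > A^r, then there are infinitely many primes p, not dividing A·B, such that the multiplicative order of -A modulo p is strictly greater than the multiplicative order of B modulo p. -/
/-- An even power of a nonsquare unit of `ZMod p` has strictly smaller order. -/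
lemma orderOf_pow_lt_of_not_isSquare {p : ℕ} [Fact p.Prime] {a : ZMod p}
    (ha : ¬ IsSquare a) {k : ℕ} (hk : Even k) : orderOf (a ^ k) < orderOf a := by
  have ha0 : a ≠ 0 := by
    rintro rfl
    exact ha ⟨0, by simp⟩
  have hpos : 0 < orderOf a :=
    orderOf_pos_iff.2 (isOfFinOrder_iff_pow_eq_one.2
      ⟨p - 1, by have := (Fact.out : p.Prime).two_le; omega, ZMod.pow_card_sub_one_eq_one ha0⟩)
  have heven : Even (orderOf a) := by
    by_contra hodd
    obtain ⟨m, hm⟩ := Nat.not_even_iff_odd.1 hodd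
    refine ha ⟨a ^ (m + 1), ?_⟩
    calc a = a ^ (2 * m + 1) * a := by rw [← hm, pow_orderOf_eq_one, one_mul]
      _ = a ^ (m + 1) * a ^ (m + 1) := by ring
  obtain ⟨m, hm⟩ := heven
  obtain ⟨l, rfl⟩ := hk
  have hpow : (a ^ (l + l)) ^ m = 1 := by
    rw [← pow_mul, show (l + l) * m = (m + m) * l by ring, ← hm, pow_mul, pow_orderOf_eq_one,
      one_pow]
  have := orderOf_le_of_pow_eq_one (by omega) hpow
  omega

/-- The Jacobi symbol of a negative integer at a number `≡ -1` modulo `4A`. -/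
lemma jacobiSym_neg_eq_neg_one {A n : ℕ} (hA : 0 < A) (hn : n % (4 * A) = 4 * A - 1) :
    jacobiSym (-A) n = -1 := by
  have hmod : n % 4 = 3 := by
    rw [← Nat.mod_mul_right_mod n 4 A, hn]
    omega
  rw [jacobiSym.mod_right (-A) (Nat.odd_iff.2 (by omega)), Int.natAbs_neg, Int.natAbs_natCast, hn]
  have hodd : Odd (4 * A - 1) := Nat.odd_iff.2 (by omega)
  have hfour : jacobiSym 4 (4 * A - 1) = 1 := by
    rw [show (4 : ℤ) = 2 ^ 2 by norm_num]
    exact jacobiSym.sq_one' (by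
      rw [show (2 : ℤ) = ((2 : ℕ) : ℤ) by rfl, Int.gcd_natCast_natCast]
      exact hodd.coprime_two_left)
  have hmul : jacobiSym (-A * 4) (4 * A - 1) = -1 := by
    rw [jacobiSym.mod_left' (a₂ := -1), jacobiSym.at_neg_one hodd, ZMod.χ₄_nat_three_mod_four]
    · omega
    · refine Int.ModEq.symm (Int.modEq_iff_dvd.2 ⟨-1, ?_⟩)
      push_cast [show 1 ≤ 4 * A by omega]
      ring
  rwa [jacobiSym.mul_left, hfour, mul_one] at hmul

/-- If `v_p(B) ≤ v_p(A ^ r)` for all primes `p ∣ A`, then `B` is the product of a divisor of `A ^ r`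
and a number coprime to `A`. -/
lemma exists_eq_mul_coprime_of_padicValNat_le {A B r : ℕ} (hB : B ≠ 0)
    (hval : ∀ p : ℕ, p.Prime → p ∣ A → padicValNat p B ≤ padicValNat p (A ^ r)) :
    ∃ b c : ℕ, B = b * c ∧ b ∣ A ^ r ∧ c.Coprime A := by
  obtain ⟨c, hc⟩ := Nat.gcd_dvd_left B (A ^ r)
  refine ⟨B.gcd (A ^ r), c, hc, Nat.gcd_dvd_right _ _, Nat.coprime_of_dvd ?_⟩
  intro p hp hpc hpA
  have : Fact p.Prime := ⟨hp⟩
  have hdvdB : p ^ padicValNat p B ∣ B.gcd (A ^ r) :=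
    Nat.dvd_gcd pow_padicValNat_dvd
      ((pow_dvd_pow p (hval p hp hpA)).trans pow_padicValNat_dvd)
  refine pow_succ_padicValNat_not_dvd (p := p) hB ?_
  conv_rhs => rw [hc]
  rw [pow_succ]
  exact mul_dvd_mul hdvdB hpc

/-- If `u` is coprime to `A`, then `A ^ r * u` divides some `A ^ r * (A ^ t - 1)`
with `t` even and positive. -/
lemma exists_even_mul_dvd_pow_mul_pow_sub_one {A u : ℕ} (r : ℕ) (hu : 0 < u) (h : u.Coprime A) :
    ∃ t : ℕ, 0 < t ∧ Even t ∧ A ^ r * u ∣ A ^ r * (A ^ t - 1) := by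
  refine ⟨u.totient * 2, by have := Nat.totient_pos.2 hu; omega, even_two.mul_left _,
    mul_dvd_mul_left _ ?_⟩
  have h1 : A ^ (u.totient * 2) ≡ 1 [MOD u] := by
    simpa [pow_mul] using (Nat.ModEq.pow_totient h.symm).pow 2
  rcases Nat.eq_zero_or_pos (A ^ (u.totient * 2)) with h0 | h0
  · simp [h0]
  · exact (Nat.modEq_iff_dvd' h0).1 h1.symm

/-- If `v_p(B) ≤ v_p(A ^ r₀)` for all primes `p ∣ A` and `r > r₀ + 3`, then `B - A ^ r`, even
multiplied by `4 * A` and a number coprime to `A`, divides some `A ^ r * (A ^ t - 1)` with `t`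
even and positive. -/
lemma exists_even_sub_mul_dvd {A B Q r₀ r : ℕ} (hQ : 0 < Q)
    (hQA : Q.Coprime A) (hr : r₀ + 3 < r) (hBA : A ^ r < B)
    (hval : ∀ p : ℕ, p.Prime → p ∣ A → padicValNat p B ≤ padicValNat p (A ^ r₀)) :
    ∃ t : ℕ, 0 < t ∧ Even t ∧ (B - A ^ r) * (4 * A * Q) ∣ A ^ r * (A ^ t - 1) := by
  obtain ⟨b, c, rfl, ⟨d, hd⟩, hc⟩ :=
    exists_eq_mul_coprime_of_padicValNat_le (by omega : B ≠ 0) hval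
  obtain ⟨e, rfl⟩ : ∃ e, r = r₀ + 3 + (e + 1) := ⟨r - r₀ - 4, by omega⟩
  have hpow : A ^ (r₀ + 3 + (e + 1)) = b * (A * (d * A ^ (e + 3))) := by
    calc A ^ (r₀ + 3 + (e + 1)) = A ^ r₀ * (A * A ^ (e + 3)) := by ring
      _ = _ := by rw [hd]; ring
  have hlt : A * (d * A ^ (e + 3)) < c := by
    rw [hpow] at hBA
    exact lt_of_mul_lt_mul_left hBA (Nat.zero_le b)
  have hm : (c - A * (d * A ^ (e + 3))).Coprime A := by
    rwa [Nat.Coprime, Nat.gcd_sub_mul_left_left hlt.le]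
  obtain ⟨v, hv0, hvA, hv⟩ : ∃ v : ℕ, 0 < v ∧ v.Coprime A ∧ 4 ∣ A ^ 2 * v := by
    rcases Nat.even_or_odd A with h | h
    · exact ⟨1, one_pos, Nat.coprime_one_left A, by
        simpa using pow_dvd_pow_of_dvd h.two_dvd 2⟩
    · exact ⟨4, by norm_num, (Nat.Coprime.pow_left 2 h.coprime_two_left), Dvd.intro_left _ rfl⟩
  obtain ⟨t, ht0, ht, hdvd⟩ := exists_even_mul_dvd_pow_mul_pow_sub_one (r₀ + 3 + (e + 1))
    (Nat.mul_pos (Nat.mul_pos (Nat.sub_pos_of_lt hlt) hv0) hQ) ((hm.mul_left hvA).mul_left hQA)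
  refine ⟨t, ht0, ht, dvd_trans ?_ hdvd⟩
  rw [hpow, ← Nat.mul_sub, ← hpow]
  set m := c - A * (d * A ^ (e + 3))
  obtain ⟨w, hw⟩ := hv
  refine ⟨d * w * A ^ (e + 1), ?_⟩
  calc A ^ (r₀ + 3 + (e + 1)) * (m * v * Q)
      = A ^ r₀ * (A ^ 2 * v) * A * A ^ (e + 1) * m * Q := by ring
    _ = _ := by rw [hd, hw]; ring

/-- Remark 2.1(i): let `A, B` be integers larger than `1`, let `r₀` be a nonnegative
integer with `v_p(A^r₀) ≥ v_p(B)` for all primes `p` dividing `A`, and let `r` be an even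
integer with `r > r₀ + 3`. If `B > A^r` then `-A, B` is order-dominant. -/
theorem order_dominant_negA_B_general (A B : ℤ) (hA : 1 < A) (hB : 1 < B)
    (r₀ r : ℕ)
    (hval : ∀ p : ℕ, p.Prime → (p : ℤ) ∣ A → padicValInt p B ≤ padicValInt p (A ^ r₀))
    (hreven : Even r) (hr : r₀ + 3 < r) (hBA : A ^ r < B) :
    {p : ℕ | p.Prime ∧ ¬ (p : ℤ) ∣ A * B ∧
      orderOf ((B : ZMod p)) < orderOf ((-A : ZMod p))}.Infinite := by
  lift A to ℕ using by omega
  lift B to ℕ using by omega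
  intro hfin
  set P := hfin.toFinset
  set Q := ∏ p ∈ P, p
  have hmem : ∀ p ∈ P, p.Prime ∧ p.Coprime A := by
    intro p hp
    obtain ⟨hpp, hndvd, -⟩ := hfin.mem_toFinset.1 hp
    refine ⟨hpp, hpp.coprime_iff_not_dvd.2 fun h => hndvd ?_⟩
    exact (Int.natCast_dvd_natCast.2 h).mul_right _
  have hQ0 : 0 < Q := Finset.prod_pos fun p hp => (hmem p hp).1.pos
  have hQA : Q.Coprime A := Nat.Coprime.prod_left fun p hp => (hmem p hp).2
  have hA' : 1 < A := by exact_mod_cast hA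
  have hBA' : A ^ r < B := by exact_mod_cast hBA
  have hval' : ∀ p : ℕ, p.Prime → p ∣ A → padicValNat p B ≤ padicValNat p (A ^ r₀) := by
    intro p hp hpA
    simpa [padicValInt, Int.natAbs_pow] using hval p hp (Int.natCast_dvd_natCast.2 hpA)
  obtain ⟨t, ht0, hteven, s, hs⟩ := exists_even_sub_mul_dvd hQ0 hQA hr hBA' hval'
  have hAt : 1 < A ^ t := Nat.one_lt_pow ht0.ne' hA'
  have hs0 : 0 < s := by
    refine Nat.pos_of_ne_zero fun h => ?_
    have : 0 < A ^ r * (A ^ t - 1) := Nat.mul_pos (by positivity) (by omega)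
    simp [hs, h] at this
  have hn0 : 0 < 4 * A * (Q * s) := by positivity
  obtain ⟨n, hn⟩ : ∃ n, n + 1 = 4 * A * (Q * s) := ⟨_, Nat.succ_pred_eq_of_pos hn0⟩
  have hnmod : n % (4 * A) = 4 * A - 1 := by
    obtain ⟨q, hq⟩ : ∃ q, q + 1 = Q * s := ⟨_, Nat.succ_pred_eq_of_pos (by positivity)⟩
    have : n = (4 * A - 1) + 4 * A * q := by
      rw [← hq, mul_add] at hn
      omega
    rw [this, Nat.add_mul_mod_self_left, Nat.mod_eq_of_lt (by omega)]
  obtain ⟨p, hp, hpn, hJ⟩ := jacobiSym.eq_neg_one_at_prime_divisor_of_eq_neg_one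
    (jacobiSym_neg_eq_neg_one (by omega) hnmod)
  have : Fact p.Prime := ⟨hp⟩
  rw [← jacobiSym.legendreSym.to_jacobiSym, legendreSym.eq_neg_one_iff] at hJ
  push_cast at hJ
  have hnot : ¬ p ∣ 4 * A * (Q * s) := by
    rw [← hn]
    exact fun h => hp.one_lt.ne' (Nat.dvd_one.1 ((Nat.dvd_add_right hpn).1 h))
  have hpA : ¬ p ∣ A := fun h => hnot ((h.mul_left 4).mul_right _)
  have hpow : (-(A : ZMod p)) ^ (r + t) = B := by
    rw [(hreven.add hteven).neg_pow]
    have hcast : ((A : ℤ) ^ (r + t) - B) = (B - A ^ r) * n := by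
      zify [hBA'.le, hAt.le] at hs hn
      linear_combination hs - ((B : ℤ) - A ^ r) * hn
    have := congrArg (Int.cast : ℤ → ZMod p) hcast
    push_cast at this
    rwa [(ZMod.natCast_eq_zero_iff n p).2 hpn, mul_zero, sub_eq_zero] at this
  have hpB : ¬ p ∣ B := by
    rw [← ZMod.natCast_eq_zero_iff, ← hpow]
    exact pow_ne_zero _ (neg_ne_zero.2 fun h => hpA ((ZMod.natCast_eq_zero_iff A p).1 h))
  have hpP : p ∈ P := by
    refine hfin.mem_toFinset.2 ⟨hp, ?_, ?_⟩
    · exact_mod_cast fun h => (hp.dvd_mul.1 h).elim hpA hpB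
    · push_cast
      rw [← hpow]
      exact orderOf_pow_lt_of_not_isSquare hJ (hreven.add hteven)
  exact hnot (((Finset.dvd_prod_of_mem _ hpP).mul_right s).mul_left _)
end

section
/- Fix an integer A > 1. Then the set of positive integers B for which there exist infinitely many primes p, not dividing A·B, with the multiplicative order of -A modulo p strictly greater than the multiplicative order of B modulo p, has asymptotic (natural) density 1 in the positive integers. -/
open NumberTheorySymbols in
theorem jacobiSym_neg_of_add_one_eq {a n c : ℕ} (ha : 0 < a) (h : n + 1 = 4 * a * c) :
    J(-(a : ℤ) | n) = -1 := by
  have hc : 0 < c := Nat.pos_of_ne_zero (by rintro rfl; simp at h)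
  have hn4 : n % 4 = 3 := by
    have : n + 1 = 4 * (a * c) := by rw [h]; ring
    omega
  have hmod : n % (4 * a) = (4 * a - 1) % (4 * a) := by
    obtain ⟨d, rfl⟩ : ∃ d, c = d + 1 := ⟨c - 1, by omega⟩
    have : n = (4 * a - 1) + 4 * a * d := by
      rw [mul_add] at h; omega
    rw [this, Nat.add_mul_mod_self_left]
  have hodd : Odd n := Nat.odd_iff.mpr (by omega)
  have hodd' : Odd (4 * a - 1) := Nat.odd_iff.mpr (by omega)
  have hquad : J((a : ℤ) | 4 * a - 1) = 1 := by
    have h4 : J((4 * a : ℤ) | 4 * a - 1) = 1 := by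
      rw [jacobiSym.mod_left' (a₂ := 1), jacobiSym.one_left]
      rw [Nat.cast_sub (by omega)]
      exact Int.emod_eq_emod_iff_emod_sub_eq_zero.mpr (by simp)
    rwa [jacobiSym.mul_left, jacobiSym.at_four hodd', one_mul] at h4
  rw [jacobiSym.neg _ hodd, ZMod.χ₄_nat_three_mod_four hn4, jacobiSym.mod_right' a hodd, hmod,
    ← jacobiSym.mod_right' a hodd', hquad]
  rfl

theorem orderOf_sq_pow_lt_of_not_isSquare {G : Type*} [Group G] [Finite G] {g : G}
    (hg : ¬ IsSquare g) (k : ℕ) : orderOf ((g ^ 2) ^ k) < orderOf g := by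
  have heven : 2 ∣ orderOf g := by
    by_contra hodd
    obtain ⟨r, hr⟩ := Nat.odd_iff.mpr (Nat.two_dvd_ne_zero.mp hodd)
    refine hg ⟨g ^ (r + 1), ?_⟩
    rw [← pow_add, show r + 1 + (r + 1) = orderOf g + 1 by omega, pow_succ, pow_orderOf_eq_one,
      one_mul]
  have hpos := orderOf_pos g
  calc orderOf ((g ^ 2) ^ k) ≤ orderOf (g ^ 2) :=
        Nat.le_of_dvd (orderOf_pos _) (orderOf_pow_dvd k)
    _ = orderOf g / 2 := orderOf_pow_of_dvd two_ne_zero heven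
    _ < orderOf g := Nat.div_lt_self hpos one_lt_two

theorem orderOf_lt_orderOf_neg_of_not_isSquare {p a b M : ℕ} [Fact p.Prime]
    (hsq : ¬ IsSquare (-(a : ZMod p))) (h : (b : ZMod p) = (a : ZMod p) ^ (2 * M)) :
    orderOf (b : ZMod p) < orderOf (-(a : ZMod p)) := by
  have h0 : -(a : ZMod p) ≠ 0 := fun h0 => hsq (h0 ▸ IsSquare.zero)
  have key := orderOf_sq_pow_lt_of_not_isSquare (g := Units.mk0 _ h0)
    (fun ⟨r, hr⟩ => hsq ⟨r, by simpa using congrArg Units.val hr⟩) M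
  rw [← orderOf_units, ← orderOf_units] at key
  simpa [h, pow_mul] using key

theorem exists_coprime_dvd_pow_mul {a j X P : ℕ} (hX : 0 < X) (hP0 : 0 < P) (hP : P.Coprime a)
    (hj : ∀ q, q.Prime → q ∣ a → ¬ q ^ j ∣ X) :
    ∃ W, 0 < W ∧ W.Coprime a ∧ 4 * a * X * P ∣ a ^ (2 * (j + 3)) * W := by
  obtain ⟨u, hu⟩ := Nat.gcd_dvd_left X (a ^ j)
  have hua : u.Coprime a := by
    refine Nat.Coprime.symm (Nat.coprime_of_dvd fun q hq hqa hqu => ?_)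
    have hmax : ∀ i ≤ j, q ^ i ∣ X.gcd (a ^ j) := by
      intro i
      induction i with
      | zero => simp
      | succ i ih =>
        intro hi
        refine Nat.dvd_gcd ?_ ((pow_dvd_pow_of_dvd hqa _).trans (pow_dvd_pow a hi))
        rw [hu, pow_succ]
        exact mul_dvd_mul (ih (by omega)) hqu
    exact hj q hq hqa ((hmax j le_rfl).trans (Nat.gcd_dvd_left _ _))
  obtain ⟨c, hc⟩ := Nat.gcd_dvd_right X (a ^ j)
  have hu0 : 0 < u := Nat.pos_of_ne_zero (by rintro rfl; omega)
  have hpow : a ^ (2 * (j + 3)) = X.gcd (a ^ j) * c * a ^ (j + 3) * a ^ 2 * a := by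
    rw [← hc]; ring
  rcases Nat.even_or_odd a with ⟨r, hr⟩ | hodd
  · refine ⟨u * P, by positivity, hua.mul_left hP, c * a ^ (j + 3) * r ^ 2, ?_⟩
    have ha2 : a ^ 2 = 4 * r ^ 2 := by rw [hr]; ring
    rw [hpow, ha2]
    generalize X.gcd (a ^ j) = g at hu
    rw [hu]; ring
  · refine ⟨4 * (u * P), by positivity,
      Nat.Coprime.mul_left (Nat.Coprime.pow_left 2 (Nat.coprime_two_left.mpr hodd))
        (hua.mul_left hP), c * a ^ (j + 3) * a ^ 2, ?_⟩
    rw [hpow]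
    generalize X.gcd (a ^ j) = g at hu
    rw [hu]; ring

theorem exists_orderOf_lt_of_coprime {a b j P : ℕ} (ha : 1 < a) (hP0 : 0 < P) (hP : P.Coprime a)
    (hb : a ^ (2 * (j + 3)) < b) (hj : ∀ q, q.Prime → q ∣ a → ¬ q ^ j ∣ b) :
    ∃ p : ℕ, p.Prime ∧ ¬ p ∣ P ∧ ¬ p ∣ a * b ∧
      orderOf (b : ZMod p) < orderOf (-(a : ZMod p)) := by
  obtain ⟨X, hX⟩ : ∃ X, b = a ^ (2 * (j + 3)) + X := ⟨b - a ^ (2 * (j + 3)), by omega⟩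
  have hjX : ∀ q, q.Prime → q ∣ a → ¬ q ^ j ∣ X := by
    intro q hq hqa hqX
    refine hj q hq hqa (hX ▸ dvd_add ?_ hqX)
    exact (pow_dvd_pow_of_dvd hqa j).trans (pow_dvd_pow a (by omega))
  obtain ⟨W, hW0, hWa, hW⟩ := exists_coprime_dvd_pow_mul (by omega : 0 < X) hP0 hP hjX
  have hWd : W ∣ a ^ (2 * W.totient) - 1 := by
    have h1 := (Nat.ModEq.pow_totient hWa.symm).pow 2
    rw [one_pow, ← pow_mul, mul_comm] at h1
    exact (Nat.modEq_iff_dvd' (Nat.one_le_pow _ _ (by omega))).mp h1.symm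
  obtain ⟨k, hk⟩ := hW.trans (mul_dvd_mul_left (a ^ (2 * (j + 3))) hWd)
  have hs : 1 < a ^ (2 * W.totient) :=
    Nat.one_lt_pow (by have := Nat.totient_pos.mpr hW0; omega) ha
  obtain ⟨M, hM⟩ : ∃ M, M = j + 3 + W.totient := ⟨_, rfl⟩
  have hpow : a ^ (2 * M) = a ^ (2 * (j + 3)) + 4 * a * X * P * k := by
    rw [← hk, hM, mul_add 2, pow_add, add_comm (a ^ (2 * (j + 3))), ← Nat.mul_succ]
    congr 1; omega
  have hk0 : 0 < k := by
    refine Nat.pos_of_ne_zero ?_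
    rintro rfl
    rw [mul_zero, mul_eq_zero, pow_eq_zero_iff'] at hk
    omega
  obtain ⟨n, hn⟩ : ∃ n, n + 1 = 4 * a * (P * k) :=
    ⟨4 * a * (P * k) - 1, Nat.sub_add_cancel
      (Nat.mul_pos (by omega) (Nat.mul_pos hP0 hk0))⟩
  have hdiff : a ^ (2 * M) = b + X * n := by
    rw [hpow, hX, show 4 * a * X * P * k = X * (4 * a * (P * k)) by ring, ← hn]; ring
  obtain ⟨p, hp, hpn, hpJ⟩ := jacobiSym.eq_neg_one_at_prime_divisor_of_eq_neg_one
    (jacobiSym_neg_of_add_one_eq (by omega : 0 < a) hn)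
  have := Fact.mk hp
  have hnd : ¬ p ∣ 4 * a * (P * k) := fun h =>
    hp.one_lt.ne' (Nat.dvd_one.mp ((Nat.dvd_add_right hpn).mp (hn ▸ h)))
  have hpa : ¬ p ∣ a := fun h => hnd ((h.mul_left 4).mul_right _)
  have hcast : (b : ZMod p) = (a : ZMod p) ^ (2 * M) := by
    have h0 : (n : ZMod p) = 0 := (ZMod.natCast_eq_zero_iff n p).mpr hpn
    have := congrArg (Nat.cast : ℕ → ZMod p) hdiff
    push_cast at this
    rw [this, h0]; ring
  have hpb : ¬ p ∣ b := fun h => hpa (hp.dvd_of_dvd_pow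
    (hdiff ▸ dvd_add h (hpn.mul_left X) : p ∣ a ^ (2 * M)))
  refine ⟨p, hp, fun h => hnd ((h.mul_right k).mul_left _), ?_, ?_⟩
  · rw [hp.dvd_mul]; tauto
  · refine orderOf_lt_orderOf_neg_of_not_isSquare ?_ hcast
    have := (ZMod.nonsquare_iff_jacobiSym_eq_neg_one).mp hpJ
    simpa using this

theorem infinite_setOf_orderOf_lt {a b j : ℕ} (ha : 1 < a)
    (hb : a ^ (2 * (j + 3)) < b) (hj : ∀ q, q.Prime → q ∣ a → ¬ q ^ j ∣ b) :
    {p : ℕ | p.Prime ∧ ¬ p ∣ a * b ∧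
      orderOf (b : ZMod p) < orderOf (-(a : ZMod p))}.Infinite := by
  intro hfin
  have hpos : 0 < ∏ p ∈ hfin.toFinset, p :=
    Finset.prod_pos fun p hp => (hfin.mem_toFinset.mp hp).1.pos
  have hcop : (∏ p ∈ hfin.toFinset, p).Coprime a := by
    refine Nat.Coprime.prod_left fun p hp => ?_
    obtain ⟨hp, hpab, -⟩ := hfin.mem_toFinset.mp hp
    exact (Nat.Prime.coprime_iff_not_dvd hp).mpr fun h => hpab (h.mul_right b)
  obtain ⟨p, hp, hpP, hpab, hlt⟩ := exists_orderOf_lt_of_coprime ha hpos hcop hb hj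
  exact hpP (Finset.dvd_prod_of_mem _ (hfin.mem_toFinset.mpr ⟨hp, hpab, hlt⟩))

theorem le_ncard_add_of_forall_mem {S : Set ℕ} {a j L : ℕ}
    (hS : ∀ b, L < b → (∀ q, q.Prime → q ∣ a → ¬ q ^ j ∣ b) → b ∈ S) (ha : 0 < a) (N : ℕ) :
    (N : ℝ) ≤ (Set.Icc 1 N ∩ S).ncard + L + a * (N / 2 ^ j) := by
  classical
  have hsub : Finset.Ioc 0 N ⊆ ({b ∈ Finset.Ioc 0 N | b ∈ S} ∪ Finset.Ioc 0 L) ∪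
      a.primeFactors.biUnion fun q => {b ∈ Finset.Ioc 0 N | q ^ j ∣ b} := by
    intro b hb
    have hS := hS b
    simp only [Finset.mem_union, Finset.mem_filter, Finset.mem_biUnion, Finset.mem_Ioc,
      Nat.mem_primeFactors] at hb ⊢
    by_contra! h
    obtain ⟨⟨h1, h2⟩, h3⟩ := h
    exact h1 hb (hS (h2 hb.1) fun q hq hqa => h3 q ⟨hq, hqa, ha.ne'⟩ hb)
  have hcard : (Set.Icc 1 N ∩ S).ncard = (Finset.filter (· ∈ S) (Finset.Ioc 0 N)).card := by
    rw [← Set.ncard_coe_finset]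
    congr 1
    ext b
    simp [Nat.succ_le_iff, and_assoc]
  have hbad : (((a.primeFactors.biUnion fun q => {b ∈ Finset.Ioc 0 N | q ^ j ∣ b}).card : ℕ) : ℝ) ≤
      a * (N / 2 ^ j) := by
    calc _ ≤ ((a.primeFactors.card * (N / 2 ^ j) : ℕ) : ℝ) := by
          refine Nat.cast_le.mpr (Finset.card_biUnion_le_card_mul _ _ _ fun q hq => ?_)
          rw [Nat.Ioc_filter_dvd_card_eq_div]
          exact Nat.div_le_div_left
            (Nat.pow_le_pow_left (Nat.prime_of_mem_primeFactors hq).two_le j) (by positivity)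
      _ ≤ a * (N / 2 ^ j) := by
          push_cast
          have h1 : a.primeFactors.card ≤ a := by
            have := Finset.card_le_card (show a.primeFactors ⊆ Finset.Ioc 0 a from fun q hq =>
              Finset.mem_Ioc.mpr ⟨(Nat.prime_of_mem_primeFactors hq).pos,
                Nat.le_of_mem_primeFactors hq⟩)
            simpa using this
          have h2 : ((N / 2 ^ j : ℕ) : ℝ) ≤ N / 2 ^ j := by
            simpa using Nat.cast_div_le (α := ℝ) (m := N) (n := 2 ^ j)
          gcongr
  have h := (Finset.card_le_card hsub).trans (Finset.card_union_le _ _)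
  have h' := Finset.card_union_le {b ∈ Finset.Ioc 0 N | b ∈ S} (Finset.Ioc 0 L)
  rw [Nat.card_Ioc, ← hcard] at h'
  rw [Nat.card_Ioc] at h
  have h'' : (N : ℝ) ≤ (Set.Icc 1 N ∩ S).ncard + L +
      (a.primeFactors.biUnion fun q => {b ∈ Finset.Ioc 0 N | q ^ j ∣ b}).card := by
    exact_mod_cast (by omega)
  linarith

theorem tendsto_ncard_div_one {S : Set ℕ} {a : ℕ} {L : ℕ → ℕ} (ha : 0 < a)
    (hS : ∀ j b, L j < b → (∀ q, q.Prime → q ∣ a → ¬ q ^ j ∣ b) → b ∈ S) :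
    Filter.Tendsto (fun N : ℕ => ((Set.Icc 1 N ∩ S).ncard : ℝ) / N) Filter.atTop (nhds 1) := by
  have hle : ∀ N : ℕ, ((Set.Icc 1 N ∩ S).ncard : ℝ) / N ≤ 1 := fun N => by
    refine div_le_one_of_le₀ (Nat.cast_le.mpr ?_) (Nat.cast_nonneg N)
    simpa using Set.ncard_le_ncard (Set.inter_subset_left : Set.Icc 1 N ∩ S ⊆ Set.Icc 1 N)
      (Set.finite_Icc 1 N)
  rw [tendsto_order]
  refine ⟨fun c hc => ?_, fun c hc => Filter.Eventually.of_forall fun N => (hle N).trans_lt hc⟩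
  obtain ⟨j, hj⟩ : ∃ j : ℕ, (a : ℝ) / 2 ^ j < (1 - c) / 2 := by
    obtain ⟨j, hj⟩ := pow_unbounded_of_one_lt ((a : ℝ) / ((1 - c) / 2)) one_lt_two
    refine ⟨j, ?_⟩
    rw [div_lt_iff₀ (by linarith)] at hj
    rw [div_lt_iff₀ (by positivity)]
    linarith
  filter_upwards [(tendsto_natCast_atTop_atTop (R := ℝ)).eventually_gt_atTop
    ((L j : ℝ) / ((1 - c) / 2)), Filter.eventually_gt_atTop 0] with N hN hN0
  have hN0' : (0 : ℝ) < N := Nat.cast_pos.mpr hN0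
  rw [div_lt_iff₀ (by linarith)] at hN
  rw [lt_div_iff₀ hN0']
  have h := le_ncard_add_of_forall_mem (hS j) ha N
  have h2 : (a : ℝ) * (N / 2 ^ j) < (1 - c) / 2 * N := by
    rw [show (a : ℝ) * (N / 2 ^ j) = a / 2 ^ j * N by ring]
    gcongr
  linarith

/-- Remark 2.1(i), consequence: for each fixed integer `A > 1`, the pair `-A, B` is
order-dominant for almost all positive integers `B` (asymptotic density `1`). -/
theorem almost_all_negA_B_order_dominant (A : ℤ) (hA : 1 < A) :
    Filter.Tendsto
      (fun N : ℕ =>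
        ((Set.Icc 1 N ∩ {B : ℕ |
          {p : ℕ | p.Prime ∧ ¬ (p : ℤ) ∣ A * B ∧
            orderOf ((B : ZMod p)) < orderOf ((-A : ZMod p))}.Infinite}).ncard : ℝ) / N)
      Filter.atTop (nhds 1) := by
  lift A to ℕ using by omega
  refine tendsto_ncard_div_one (a := A) (L := fun j => A ^ (2 * (j + 3))) (by omega)
    fun j b hb hj => ?_
  have h := infinite_setOf_orderOf_lt (by omega) hb hj
  simp only [Set.mem_ofPred_eq, Int.cast_natCast]
  exact_mod_cast h
end

section
/- There are infinitely many primes p, not dividing 21, with ord_p(3) > ord_p(7); and there are infinitely many primes p, not dividing 6, with ord_p(2) > ord_p(6). -/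
/-- If `a` is not a square, then every element whose order divides that of `a ^ 2` has order
smaller than `a`. -/
theorem orderOf_lt_of_not_isSquare {M : Type*} [Monoid M] {a b : M} (ha : ¬ IsSquare a)
    (hpos : 0 < orderOf a) (h : orderOf b ∣ orderOf (a ^ 2)) : orderOf b < orderOf a := by
  have heven : 2 ∣ orderOf a := by
    by_contra hodd
    obtain ⟨k, hk⟩ : Odd (orderOf a) := by
      rwa [← Nat.not_even_iff_odd, even_iff_two_dvd]
    refine ha ⟨a ^ (k + 1), ?_⟩
    rw [← pow_add, show k + 1 + (k + 1) = orderOf a + 1 by omega, pow_succ, pow_orderOf_eq_one,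
      one_mul]
  rw [orderOf_pow_of_dvd two_ne_zero heven] at h
  have := Nat.le_of_dvd (by omega) h
  omega

theorem ZMod.orderOf_pos_of_ne_zero {p : ℕ} [Fact p.Prime] {a : ZMod p} (ha : a ≠ 0) :
    0 < orderOf a :=
  orderOf_pos_iff.2 (isOfFinOrder_iff_pow_eq_one.2
    ⟨p - 1, Nat.sub_pos_of_lt (Fact.out : p.Prime).one_lt, ZMod.pow_card_sub_one_eq_one ha⟩)

theorem ZMod.pow_factorial_eq_one {p N : ℕ} [Fact p.Prime] (hN : p ≤ N) {a : ZMod p}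
    (ha : a ≠ 0) : a ^ N.factorial = 1 := by
  have hp := (Fact.out : p.Prime).one_lt
  obtain ⟨c, hc⟩ := Nat.dvd_factorial (show 0 < p - 1 by omega) (show p - 1 ≤ N by omega)
  rw [hc, pow_mul, ZMod.pow_card_sub_one_eq_one ha, one_pow]

/-- For `k ≥ 1` some prime factor of `(7 * 9 ^ k - 1) / 2` has `3` as a quadratic nonresidue. -/
theorem exists_prime_seven_mul_nine_pow_eq_one {k : ℕ} (hk : 0 < k) :
    ∃ p : ℕ, p.Prime ∧ p ≠ 2 ∧ (7 * 9 ^ k : ZMod p) = 1 ∧ ¬ IsSquare (3 : ZMod p) := by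
  obtain ⟨t, ht⟩ : ∃ t, 9 ^ k = 24 * t + 9 := by
    induction k, hk using Nat.le_induction with
    | base => exact ⟨0, rfl⟩
    | succ n _ ih =>
      obtain ⟨t, ht⟩ := ih
      exact ⟨9 * t + 3, by rw [pow_succ, ht]; ring⟩
  have hJ : jacobiSym 3 (84 * t + 31) = -1 := by
    rw [jacobiSym.mod_right 3 (by grind), show (84 * t + 31) % (4 * (3 : ℤ).natAbs) = 7 by
      change (84 * t + 31) % 12 = 7
      omega]
    norm_num
  obtain ⟨p, hp, hdvd, hJp⟩ := jacobiSym.eq_neg_one_at_prime_divisor_of_eq_neg_one hJ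
  refine ⟨p, hp, ?_, ?_, by simpa using ZMod.nonsquare_of_jacobiSym_eq_neg_one hJp⟩
  · rintro rfl
    omega
  · have h0 : ((84 * t + 31 : ℕ) : ZMod p) = 0 := (ZMod.natCast_eq_zero_iff _ _).2 hdvd
    have h9 : ((9 ^ k : ℕ) : ZMod p) = ((24 * t + 9 : ℕ) : ZMod p) := by rw [ht]
    push_cast at h0 h9
    linear_combination 7 * h9 + 2 * h0

/-- For `k ≥ 1` some prime factor of `2 * 4 ^ k - 3` has `2` as a quadratic nonresidue. -/
theorem exists_prime_two_mul_four_pow_eq_three {k : ℕ} (hk : 0 < k) :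
    ∃ p : ℕ, p.Prime ∧ (2 * 4 ^ k : ZMod p) = 3 ∧ ¬ IsSquare (2 : ZMod p) := by
  obtain ⟨t, ht⟩ : ∃ t, 4 ^ k = 4 * t + 4 := by
    obtain ⟨n, rfl⟩ := Nat.exists_eq_add_of_lt hk
    have := Nat.one_le_pow n 4 (by norm_num)
    exact ⟨4 ^ n - 1, by rw [zero_add, pow_succ]; omega⟩
  have hJ : jacobiSym 2 (8 * t + 5) = -1 := by
    rw [jacobiSym.mod_right 2 (by grind), show (8 * t + 5) % (4 * (2 : ℤ).natAbs) = 5 by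
      change (8 * t + 5) % 8 = 5
      omega]
    norm_num
  obtain ⟨p, hp, hdvd, hJp⟩ := jacobiSym.eq_neg_one_at_prime_divisor_of_eq_neg_one hJ
  refine ⟨p, hp, ?_, by simpa using ZMod.nonsquare_of_jacobiSym_eq_neg_one hJp⟩
  have h0 : ((8 * t + 5 : ℕ) : ZMod p) = 0 := (ZMod.natCast_eq_zero_iff _ _).2 hdvd
  have h4 : ((4 ^ k : ℕ) : ZMod p) = ((4 * t + 4 : ℕ) : ZMod p) := by rw [ht]
  push_cast at h0 h4
  linear_combination 2 * h4 + h0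

/-- Remark 2.1(ii): the pair `3, 7` is order-dominant, as is the pair `2, 6`. -/
theorem order_dominant_three_seven_and_two_six :
    {p : ℕ | p.Prime ∧ ¬ p ∣ 21 ∧
      orderOf ((7 : ZMod p)) < orderOf ((3 : ZMod p))}.Infinite ∧
    {p : ℕ | p.Prime ∧ ¬ p ∣ 6 ∧
      orderOf ((6 : ZMod p)) < orderOf ((2 : ZMod p))}.Infinite := by
  constructor
  · refine Set.infinite_of_forall_exists_gt fun N ↦ ?_
    obtain ⟨p, hp, hp2, hpow, hsq⟩ := exists_prime_seven_mul_nine_pow_eq_one N.factorial_pos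
    have : Fact p.Prime := ⟨hp⟩
    have h3 : (3 : ZMod p) ≠ 0 := fun h ↦ hsq (h ▸ IsSquare.zero)
    have h9 : (9 : ZMod p) = 3 ^ 2 := by norm_num
    have h7 : (7 : ZMod p) ≠ 0 := by
      intro h
      simp [h] at hpow
    refine ⟨p, ⟨hp, fun h ↦ ?_, ?_⟩, ?_⟩
    · have h21 : ((21 : ℕ) : ZMod p) = 0 := (ZMod.natCast_eq_zero_iff _ _).2 h
      refine mul_ne_zero h3 h7 ?_
      push_cast at h21
      linear_combination h21
    · refine orderOf_lt_of_not_isSquare hsq (ZMod.orderOf_pos_of_ne_zero h3)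
        (orderOf_dvd_of_pow_eq_one ?_)
      have h := congrArg (· ^ orderOf ((3 : ZMod p) ^ 2)) hpow
      simpa only [mul_pow, h9, pow_right_comm _ N.factorial, pow_orderOf_eq_one, one_pow,
        mul_one] using h
    · by_contra! hle
      have h9' : (9 : ZMod p) ≠ 0 := h9 ▸ pow_ne_zero 2 h3
      rw [ZMod.pow_factorial_eq_one hle h9'] at hpow
      have h2 : ((2 : ℕ) : ZMod p) ≠ 0 := fun h ↦
        hp2 ((Nat.prime_dvd_prime_iff_eq hp Nat.prime_two).1 ((ZMod.natCast_eq_zero_iff _ _).1 h))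
      push_cast at h2
      exact mul_ne_zero h2 h3 (by linear_combination hpow)
  · refine Set.infinite_of_forall_exists_gt fun N ↦ ?_
    obtain ⟨p, hp, hpow, hsq⟩ := exists_prime_two_mul_four_pow_eq_three N.factorial_pos
    have : Fact p.Prime := ⟨hp⟩
    have h2 : (2 : ZMod p) ≠ 0 := fun h ↦ hsq (h ▸ IsSquare.zero)
    have h4 : (4 : ZMod p) = 2 ^ 2 := by norm_num
    have h3 : (3 : ZMod p) ≠ 0 := by
      rw [← hpow, h4]
      exact mul_ne_zero h2 (pow_ne_zero _ (pow_ne_zero _ h2))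
    refine ⟨p, ⟨hp, fun h ↦ ?_, ?_⟩, ?_⟩
    · have h6 : ((6 : ℕ) : ZMod p) = 0 := (ZMod.natCast_eq_zero_iff _ _).2 h
      refine mul_ne_zero h2 h3 ?_
      push_cast at h6
      linear_combination h6
    · refine orderOf_lt_of_not_isSquare hsq (ZMod.orderOf_pos_of_ne_zero h2) ?_
      have h6 : (6 : ZMod p) = (2 ^ 2) ^ (N.factorial + 1) := by
        rw [← h4, pow_succ]
        linear_combination -2 * hpow
      exact h6 ▸ orderOf_pow_dvd _
    · by_contra! hle
      have h4' : (4 : ZMod p) ≠ 0 := h4 ▸ pow_ne_zero 2 h2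
      rw [ZMod.pow_factorial_eq_one hle h4'] at hpow
      exact one_ne_zero (α := ZMod p) (by linear_combination -hpow)
end

section
/- For any two distinct elements A and B of the set {2, 3, 5, 7}, there are infinitely many primes p, not dividing A·B, such that the multiplicative order of A modulo p is strictly greater than the multiplicative order of B modulo p. -/
/-- If `J(a | M) = -1` and modulo `M` either `b` or `b⁻¹` is the even power `a ^ e`, then some
prime factor `p` of `M` satisfies `ord_p(b) < ord_p(a)`; moreover `p` is larger than any `n` such
that `q - 1 ∣ e` for all primes `q ≤ n`. -/
theorem exists_prime_gt_orderOf_lt {a b c e n x y M : ℕ} (hb : 1 ≤ b) (he0 : e ≠ 0)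
    (he : 2 ∣ e) (hn : ∀ q : ℕ, q.Prime → q ≤ n → q - 1 ∣ e) (hJ : jacobiSym a M = -1)
    (hco : M.Coprime (b - 1)) (hM : a ^ e * y = c * M + x)
    (hxy : (x = b ∧ y = 1) ∨ (x = 1 ∧ y = b)) :
    ∃ p, (p.Prime ∧ ¬ p ∣ a * b ∧ orderOf ((b : ZMod p)) < orderOf ((a : ZMod p))) ∧ n < p := by
  obtain ⟨p, hp, hpM, hJp⟩ := jacobiSym.eq_neg_one_at_prime_divisor_of_eq_neg_one hJ
  have : Fact p.Prime := ⟨hp⟩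
  have hsq : ¬ IsSquare (a : ZMod p) := by
    simpa using ZMod.nonsquare_of_jacobiSym_eq_neg_one hJp
  have ha0 : (a : ZMod p) ≠ 0 := fun h => hsq (h ▸ IsSquare.zero)
  have hp0 : (M : ZMod p) = 0 := (ZMod.natCast_eq_zero_iff _ _).2 hpM
  have hMp : (a : ZMod p) ^ e * y = x := by
    simpa [hp0] using congrArg (Nat.cast : ℕ → ZMod p) hM
  have hpow : (b : ZMod p) = (a : ZMod p) ^ e ∨ (b : ZMod p) = ((a : ZMod p) ^ e)⁻¹ := by
    rcases hxy with ⟨rfl, rfl⟩ | ⟨rfl, rfl⟩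
    · left; simpa using hMp.symm
    · right; exact eq_inv_of_mul_eq_one_right (by simpa using hMp)
  have hb0 : (b : ZMod p) ≠ 0 := by
    rcases hpow with h | h <;> rw [h] <;> simp [ha0]
  have hord : orderOf (b : ZMod p) = orderOf ((a : ZMod p) ^ e) := by
    rcases hpow with h | h
    · rw [h]
    · rw [h, orderOf_eq_orderOf_iff]
      simp
  have hpos : 0 < orderOf (a : ZMod p) :=
    orderOf_pos_iff.2 (isOfFinOrder_iff_pow_eq_one.2
      ⟨p - 1, Nat.sub_pos_of_lt hp.one_lt, ZMod.pow_card_sub_one_eq_one ha0⟩)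
  have heven : 2 ∣ orderOf (a : ZMod p) := by
    by_contra h
    obtain ⟨k, hk⟩ : Odd (orderOf (a : ZMod p)) := by
      rw [← Nat.not_even_iff_odd, even_iff_two_dvd]; exact h
    refine hsq ⟨(a : ZMod p) ^ (k + 1), ?_⟩
    have h1 := pow_orderOf_eq_one (a : ZMod p)
    rw [hk] at h1
    calc (a : ZMod p) = (a : ZMod p) ^ (2 * k + 1) * a := by rw [h1, one_mul]
      _ = _ := by ring
  refine ⟨p, ⟨hp, ?_, ?_⟩, ?_⟩
  · rw [← ZMod.natCast_eq_zero_iff]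
    push_cast
    exact mul_ne_zero ha0 hb0
  · rw [hord, orderOf_pow' _ he0]
    exact Nat.div_lt_self hpos (Nat.le_of_dvd (Nat.gcd_pos_of_pos_left _ hpos)
      (Nat.dvd_gcd heven he))
  · by_contra! hle
    have h1 : (a : ZMod p) ^ e = 1 := by
      obtain ⟨k, rfl⟩ := hn p hp hle
      rw [pow_mul, ZMod.pow_card_sub_one_eq_one ha0, one_pow]
    have hb1 : (b : ZMod p) = 1 := by
      rcases hpow with h | h <;> simp [h, h1]
    have hdvd : p ∣ b - 1 := by
      rw [← ZMod.natCast_eq_zero_iff, Nat.cast_sub hb, hb1]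
      simp
    exact hp.one_lt.ne' (Nat.eq_one_of_dvd_coprimes hco hpM hdvd)

/-- A numerical criterion for infinitely many primes `p` with `ord_p(b) < ord_p(a)`: the modulus
`c * (4 * a * (b - 1))` sees `a ^ 48` as an idempotent, so `s` prescribes the residue of
`(a ^ (48 * m) * y - x) / c` modulo `4 * a * (b - 1)` for every `m > 0`. -/
theorem infinite_setOf_orderOf_lt_s15 {a b : ℕ} (c s x y : ℕ) (hc : 0 < c) (hb : 1 ≤ b)
    (hu : a ^ 48 * a ^ 48 ≡ a ^ 48 [MOD c * (4 * a * (b - 1))])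
    (hs : a ^ 48 * y ≡ c * s + x [MOD c * (4 * a * (b - 1))])
    (hx : x ≤ a ^ 48 * y) (ha : 0 < a) (hodd : Odd s) (hJ : jacobiSym a s = -1)
    (hco : s.Coprime (b - 1)) (hxy : (x = b ∧ y = 1) ∨ (x = 1 ∧ y = b)) :
    {p : ℕ | p.Prime ∧ ¬ p ∣ a * b ∧
      orderOf ((b : ZMod p)) < orderOf ((a : ZMod p))}.Infinite := by
  refine Set.infinite_of_forall_exists_gt fun n => ?_
  have hpow : ∀ m, 0 < m → (a ^ 48) ^ m ≡ a ^ 48 [MOD c * (4 * a * (b - 1))] := by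
    intro m hm
    induction m, hm using Nat.le_induction with
    | base => simp [Nat.ModEq.refl]
    | succ m _ ih => rw [pow_succ]; exact (ih.mul_right _).trans hu
  have ht : a ^ (48 * n.factorial) * y ≡ c * s + x [MOD c * (4 * a * (b - 1))] := by
    rw [pow_mul]
    exact ((hpow _ n.factorial_pos).mul_right y).trans hs
  have hle : x ≤ a ^ (48 * n.factorial) * y :=
    hx.trans (Nat.mul_le_mul_right _
      (Nat.pow_le_pow_right ha (Nat.le_mul_of_pos_right _ n.factorial_pos)))
  obtain ⟨r, hr⟩ := Nat.exists_eq_add_of_le' hle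
  rw [hr] at ht
  have hrs : r ≡ c * s [MOD c * (4 * a * (b - 1))] := Nat.ModEq.add_right_cancel' x ht
  obtain ⟨M, rfl⟩ : c ∣ r :=
    ((hrs.of_mul_right _).dvd_iff dvd_rfl).2 (dvd_mul_right c s)
  have hMs : M ≡ s [MOD 4 * a * (b - 1)] := Nat.ModEq.mul_left_cancel' hc.ne' hrs
  have hMs' : M ≡ s [MOD 4 * a] := hMs.of_mul_right _
  have hMo : Odd M := by
    have h2 : M ≡ s [MOD 2] := hMs'.of_dvd ⟨2 * a, by ring⟩
    exact Nat.odd_iff.2 (Eq.trans h2 (Nat.odd_iff.1 hodd))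
  have hJM : jacobiSym a M = -1 := by
    rw [← hJ, jacobiSym.mod_right _ hMo, jacobiSym.mod_right _ hodd, Int.natAbs_natCast, hMs']
  have hcoM : M.Coprime (b - 1) := (hMs.of_mul_left _).gcd_eq.trans hco
  exact exists_prime_gt_orderOf_lt hb
    (Nat.mul_ne_zero (by norm_num) n.factorial_ne_zero) (Dvd.dvd.mul_right (by norm_num) _)
    (fun q hq hqn => Dvd.dvd.mul_left
      (Nat.dvd_factorial (Nat.sub_pos_of_lt hq.one_lt) ((Nat.sub_le q 1).trans hqn)) _)
    hJM hcoM hr hxy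

/-- Consequence of Theorem 1.1: if `A` and `B` are distinct elements of `{2, 3, 5, 7}`,
then there are infinitely many primes `p` with `ord_p(A) > ord_p(B)`. -/
theorem order_dominant_small_primes (A B : ℕ) (hA : A ∈ ({2, 3, 5, 7} : Set ℕ))
    (hB : B ∈ ({2, 3, 5, 7} : Set ℕ)) (hAB : A ≠ B) :
    {p : ℕ | p.Prime ∧ ¬ p ∣ A * B ∧
      orderOf ((B : ZMod p)) < orderOf ((A : ZMod p))}.Infinite := by
  rcases hA with rfl | rfl | rfl | rfl <;> rcases hB with rfl | rfl | rfl | rfl <;>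
    first | exact absurd rfl hAB | skip
  · apply infinite_setOf_orderOf_lt_s15 1 13 3 1 <;> norm_num [Nat.ModEq, Nat.odd_iff]
  · apply infinite_setOf_orderOf_lt_s15 1 27 5 1 <;> norm_num [Nat.ModEq, Nat.odd_iff]
  · apply infinite_setOf_orderOf_lt_s15 3 19 7 1 <;> norm_num [Nat.ModEq, Nat.odd_iff]
  · apply infinite_setOf_orderOf_lt_s15 1 7 2 1 <;> norm_num [Nat.ModEq, Nat.odd_iff]
  · apply infinite_setOf_orderOf_lt_s15 4 31 5 1 <;> norm_num [Nat.ModEq, Nat.odd_iff]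
  · apply infinite_setOf_orderOf_lt_s15 2 67 1 7 <;> norm_num [Nat.ModEq, Nat.odd_iff]
  · apply infinite_setOf_orderOf_lt_s15 1 3 2 1 <;> norm_num [Nat.ModEq, Nat.odd_iff]
  · apply infinite_setOf_orderOf_lt_s15 2 17 1 3 <;> norm_num [Nat.ModEq, Nat.odd_iff]
  · apply infinite_setOf_orderOf_lt_s15 6 23 7 1 <;> norm_num [Nat.ModEq, Nat.odd_iff]
  · apply infinite_setOf_orderOf_lt_s15 1 13 1 2 <;> norm_num [Nat.ModEq, Nat.odd_iff]
  · apply infinite_setOf_orderOf_lt_s15 2 23 3 1 <;> norm_num [Nat.ModEq, Nat.odd_iff]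
  · apply infinite_setOf_orderOf_lt_s15 4 95 5 1 <;> norm_num [Nat.ModEq, Nat.odd_iff]
end

section
/- There are infinitely many primes p, not dividing 6, such that the multiplicative order of 4 modulo p is strictly greater than the multiplicative order of 3 modulo p. -/
/-- If every prime factor of `x ^ 2 + 3 * y ^ 2` has the form `c ^ 2 + 27 * d ^ 2`,
then `y` is divisible by `3`. -/
theorem three_dvd_of_forall_prime_eq_sq_add (N : ℕ) (hN : 0 < N) (x y : ℤ)
    (hxy : (N : ℤ) = x ^ 2 + 3 * y ^ 2)
    (h : ∀ p : ℕ, p.Prime → p ∣ N → ∃ c d : ℤ, (p : ℤ) = c ^ 2 + 27 * d ^ 2) : 3 ∣ y := by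
  induction N using induction_on_primes generalizing x y with
  | zero => omega
  | one =>
    have : y = 0 := by
      by_contra hy
      have : 0 < y ^ 2 := by positivity
      push_cast at hxy
      nlinarith [sq_nonneg x]
    simp [this]
  | prime_mul p a hp ih =>
    have hp' : Prime (p : ℤ) := Nat.prime_iff_prime_int.mp hp
    have hp0 : (p : ℤ) ≠ 0 := hp'.ne_zero
    push_cast at hxy
    have key : ∃ c d : ℤ, (p : ℤ) = c ^ 2 + 27 * d ^ 2 ∧ (p : ℤ) ∣ x * (3 * d) - y * c := by
      obtain ⟨c, d, hcd⟩ := h p hp (dvd_mul_right _ _)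
      have hdvd : (p : ℤ) ∣ (x * (3 * d) - y * c) * (x * (3 * d) + y * c) :=
        ⟨9 * d ^ 2 * a - y ^ 2, by linear_combination (-9 * d ^ 2) * hxy + y ^ 2 * hcd⟩
      rcases hp'.dvd_or_dvd hdvd with h1 | h1
      · exact ⟨c, d, hcd, h1⟩
      · refine ⟨c, -d, by rw [hcd]; ring, ?_⟩
        rw [← dvd_neg]
        convert h1 using 1
        ring
    obtain ⟨c, d, hcd, y', hy'⟩ := key
    have hx : (p : ℤ) ∣ x * c + 9 * y * d := by
      refine hp'.dvd_of_dvd_pow (n := 2) ⟨p * a - 3 * p * y' ^ 2, ?_⟩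
      linear_combination (-c ^ 2 - 27 * d ^ 2) * hxy - p * a * hcd -
        3 * (x * (3 * d) - y * c + p * y') * hy'
    obtain ⟨x', hx'⟩ := hx
    have ha : (a : ℤ) = x' ^ 2 + 3 * y' ^ 2 := by
      apply mul_left_cancel₀ (pow_ne_zero 2 hp0)
      linear_combination (c ^ 2 + 27 * d ^ 2) * hxy + p * a * hcd +
        3 * (x * (3 * d) - y * c + p * y') * hy' + (x * c + 9 * y * d + p * x') * hx'
    obtain ⟨z, hz⟩ := ih (Nat.pos_of_mul_pos_left hN) x' y' ha
      fun q hq hqa => h q hq (hqa.mul_left p)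
    have hyc : (3 : ℤ) ∣ y * c := ⟨x * d - p * z, by linear_combination -hy' - p * hz⟩
    refine (Int.prime_three.dvd_or_dvd hyc).resolve_right ?_
    rintro ⟨e, rfl⟩
    have h9 : (3 * 3 : ℤ) ∣ p := ⟨e ^ 2 + 3 * d ^ 2, by linear_combination hcd⟩
    have h9' : 3 * 3 ∣ p := by exact_mod_cast h9
    have := Nat.isUnit_iff.mp (hp.prime.irreducible.squarefree 3 h9')
    omega

section CubeRoot

variable {μ : ℂ}

theorem exists_int_add_mul_of_mem_adjoin (hμ : μ ^ 2 + μ + 1 = 0) {z : ℂ}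
    (hz : z ∈ Algebra.adjoin ℤ {μ}) : ∃ a b : ℤ, z = a + b * μ := by
  induction hz using Algebra.adjoin_induction with
  | mem x hx => exact ⟨0, 1, by simp_all⟩
  | algebraMap r => exact ⟨r, 0, by simp⟩
  | add x y _ _ hx hy =>
    obtain ⟨a, b, rfl⟩ := hx
    obtain ⟨c, d, rfl⟩ := hy
    exact ⟨a + c, b + d, by push_cast; ring⟩
  | mul x y _ _ hx hy =>
    obtain ⟨a, b, rfl⟩ := hx
    obtain ⟨c, d, rfl⟩ := hy
    refine ⟨a * c - b * d, a * d + b * c - b * d, ?_⟩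
    push_cast
    linear_combination (b * d : ℂ) * hμ

theorem eq_zero_of_int_add_mul_eq_zero (hμ : μ ^ 2 + μ + 1 = 0) {a b : ℤ}
    (h : (a + b * μ : ℂ) = 0) : b = 0 := by
  have h1 : ((a ^ 2 - a * b + b ^ 2 : ℤ) : ℂ) = 0 := by
    push_cast
    linear_combination (a + b * μ ^ 2) * h - (a * b + b ^ 2 * (μ - 1)) * hμ
  have h2 : a ^ 2 - a * b + b ^ 2 = 0 := by exact_mod_cast h1
  have h3 : b ^ 2 = 0 := le_antisymm (by nlinarith [sq_nonneg (2 * a - b)]) (sq_nonneg b)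
  exact (pow_eq_zero_iff two_ne_zero).mp h3

end CubeRoot

/-- A Jacobi sum `J(χ, χ)` with `χ 2 = 1` is congruent to `1` modulo `2`. -/
theorem exists_jacobiSum_self_eq_one_add_two_mul {F : Type*} [Field F] [Fintype F]
    (h2 : (2 : F) ≠ 0) {R : Type*} [CommRing R] (A : Subalgebra ℤ R) (χ : MulChar F R)
    (hχ : ∀ x, χ x ∈ A) (hχ2 : χ 2 = 1) : ∃ w ∈ A, jacobiSum χ χ = 1 + 2 * w := by
  classical
  let f : F → A := fun x => ⟨χ x * χ (1 - x), A.mul_mem (hχ _) (hχ _)⟩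
  let π := Ideal.Quotient.mk (Ideal.span {(2 : A)})
  have hsum : ∑ x ∈ Finset.univ.erase (2⁻¹ : F), π (f x) = 0 := by
    refine Finset.sum_involution (fun x _ => 1 - x) ?_ ?_ ?_ ?_
    · intro x _
      have : f (1 - x) = f x := Subtype.ext (by simp [f, mul_comm])
      rw [this, ← map_add, ← two_mul]
      exact Ideal.Quotient.eq_zero_iff_mem.mpr
        (Ideal.mul_mem_right _ _ (Ideal.mem_span_singleton_self 2))
    · intro x hx _ hx'
      apply Finset.ne_of_mem_erase hx
      apply eq_inv_of_mul_eq_one_left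
      linear_combination -hx'
    · intro x hx
      refine Finset.mem_erase.mpr ⟨fun hx' => Finset.ne_of_mem_erase hx ?_, Finset.mem_univ _⟩
      field_simp at hx' ⊢
      linear_combination -hx'
    · intro x _
      ring
  have hinv : χ 2⁻¹ = 1 := by
    have : χ 2⁻¹ * χ 2 = 1 := by rw [← map_mul, inv_mul_cancel₀ h2, map_one]
    rwa [hχ2, mul_one] at this
  have hhalf : (f 2⁻¹ : R) = 1 := by
    have : (1 - 2⁻¹ : F) = 2⁻¹ := by field_simp; norm_num
    simp [f, this, hinv]
  rw [← map_sum, Ideal.Quotient.eq_zero_iff_mem, Ideal.mem_span_singleton'] at hsum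
  obtain ⟨w, hw⟩ := hsum
  refine ⟨w, w.2, ?_⟩
  have hJ : jacobiSum χ χ = ((∑ x, f x : A) : R) := by simp [jacobiSum, f]
  rw [hJ, ← Finset.add_sum_erase _ _ (Finset.mem_univ (2⁻¹ : F)), ← hw]
  push_cast
  rw [hhalf, mul_comm (w : R)]
  rfl

/-- If `p ≡ 1 mod 3` and `2` has order prime to `3` modulo `p`, then `p = c ^ 2 + 27 * d ^ 2`. -/
theorem exists_eq_sq_add_of_not_three_dvd_orderOf_two (p : ℕ) [Fact p.Prime] (hp2 : p ≠ 2)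
    (hp3 : 3 ∣ p - 1) (h : ¬ 3 ∣ orderOf (2 : ZMod p)) :
    ∃ c d : ℤ, (p : ℤ) = c ^ 2 + 27 * d ^ 2 := by
  have hp : p.Prime := Fact.out
  obtain ⟨μ, hμ⟩ : ∃ μ : ℂ, IsPrimitiveRoot μ 3 :=
    ⟨_, Complex.isPrimitiveRoot_exp 3 (by norm_num)⟩
  have hμ1 : μ ^ 2 + μ + 1 = 0 := by
    have := hμ.geom_sum_eq_zero (by norm_num)
    simp [Finset.sum_range_succ] at this
    linear_combination this
  have hcard : 3 ∣ Fintype.card (ZMod p) - 1 := by rwa [ZMod.card]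
  obtain ⟨χ, hχ⟩ := MulChar.exists_mulChar_orderOf (ZMod p) hcard hμ
  have hχ3 : χ ^ 3 = 1 := hχ ▸ pow_orderOf_eq_one χ
  have h20 : (2 : ZMod p) ≠ 0 := by
    intro h0
    have : ((2 : ℕ) : ZMod p) = 0 := by exact_mod_cast h0
    rw [ZMod.natCast_eq_zero_iff] at this
    exact hp2 ((Nat.prime_dvd_prime_iff_eq hp Nat.prime_two).mp this)
  have hχ2 : χ 2 = 1 := by
    have h1 : orderOf (χ 2) ∣ 3 := by
      rw [orderOf_dvd_iff_pow_eq_one, ← MulChar.pow_apply' χ (by norm_num), hχ3,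
        MulChar.one_apply h20.isUnit]
    have h2 : orderOf (χ 2) ∣ orderOf (2 : ZMod p) := by
      rw [orderOf_dvd_iff_pow_eq_one, ← map_pow, pow_orderOf_eq_one, map_one]
    rcases (Nat.dvd_prime Nat.prime_three).mp h1 with h3 | h3
    · exact orderOf_eq_one_iff.mp h3
    · exact absurd (h3 ▸ h2) h
  obtain ⟨w, hw, hJw⟩ := exists_jacobiSum_self_eq_one_add_two_mul h20 (Algebra.adjoin ℤ {μ}) χ
    (MulChar.apply_mem_algebraAdjoin_of_pow_eq_one hχ3 hμ) hχ2
  obtain ⟨z, hz, hJz⟩ := exists_jacobiSum_eq_neg_one_add (by norm_num) hχ3 hχ3 hcard hμ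
  obtain ⟨u, v, rfl⟩ := exists_int_add_mul_of_mem_adjoin hμ1 hz
  obtain ⟨s, t, rfl⟩ := exists_int_add_mul_of_mem_adjoin hμ1 hw
  have hst : 3 * (v - u) - 2 * t = 0 := by
    refine eq_zero_of_int_add_mul_eq_zero hμ1 (a := -2 + 3 * v - 2 * s) ?_
    push_cast
    linear_combination hJw - hJz - (v * μ + u - 3 * v : ℂ) * hμ1
  obtain ⟨d, hd⟩ : (2 : ℤ) ∣ v - u := by omega
  have hu : u = v - 2 * d := by linarith
  subst hu
  have hJ : jacobiSum χ χ = ((3 * v - 1 : ℤ) : ℂ) + ((6 * d : ℤ) : ℂ) * μ := by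
    rw [hJz]
    push_cast
    linear_combination (v * μ + (v - 2 * d) - 3 * v : ℂ) * hμ1
  have hconj : (starRingEnd ℂ) μ * μ = 1 := by
    rw [← Complex.normSq_eq_conj_mul_self, Complex.normSq_eq_norm_sq,
      hμ.norm'_eq_one (by norm_num)]
    simp
  have hJinv : jacobiSum χ⁻¹ χ⁻¹ =
      ((3 * v - 1 : ℤ) : ℂ) + ((6 * d : ℤ) : ℂ) * (starRingEnd ℂ) μ := by
    have : χ⁻¹ = χ.ringHomComp (starRingEnd ℂ) := by
      ext a
      simp [← MulChar.star_apply']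
    rw [this, jacobiSum_ringHomComp, hJ, map_add, map_mul, map_intCast, map_intCast]
  have hconj' : (starRingEnd ℂ) μ = -1 - μ := by
    linear_combination (starRingEnd ℂ μ) * hμ1 - (μ + 1) * hconj
  have hχ1 : χ ≠ 1 := by
    rintro rfl
    simp at hχ
  have hχχ : χ * χ ≠ 1 := by
    rw [← sq]
    intro h2
    have := orderOf_dvd_of_pow_eq_one h2
    rw [hχ] at this
    omega
  have hchar : ringChar ℂ ≠ ringChar (ZMod p) := by
    rw [ringChar.eq_zero, ZMod.ringChar_zmod_n]
    exact hp.ne_zero.symm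
  have hmul := jacobiSum_mul_jacobiSum_inv hchar hχ1 hχ1 hχχ
  rw [hJ, hJinv, hconj', ZMod.card] at hmul
  refine ⟨3 * v - 1 - 3 * d, d, ?_⟩
  have : ((p : ℤ) : ℂ) = (((3 * v - 1 - 3 * d) ^ 2 + 27 * d ^ 2 : ℤ) : ℂ) := by
    push_cast at hmul ⊢
    linear_combination -hmul - 36 * (d : ℂ) ^ 2 * hμ1
  exact_mod_cast this

theorem three_dvd_sub_one_of_sq_eq_neg_three {p : ℕ} [Fact p.Prime] (h2 : (2 : ZMod p) ≠ 0)
    (h3 : (3 : ZMod p) ≠ 0) {x : ZMod p} (hx : x ^ 2 = -3) : 3 ∣ p - 1 := by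
  have hy3 : ((x - 1) / 2) ^ 3 = 1 := by
    field_simp
    linear_combination (x - 3) * hx
  have hy1 : (x - 1) / 2 ≠ 1 := by
    intro h
    have hx3 : x = 3 := by
      field_simp at h
      linear_combination h
    rw [hx3] at hx
    have : (2 : ZMod p) * 2 * 3 = 0 := by linear_combination hx
    simp [h2, h3] at this
  have hy0 : (x - 1) / 2 ≠ 0 := by
    intro h
    simp [h] at hy3
  rw [← orderOf_eq_prime hy3 hy1]
  exact ZMod.orderOf_dvd_card_sub_one hy0

theorem orderOf_three_lt_orderOf_four {p : ℕ} [Fact p.Prime] (h2 : (2 : ZMod p) ≠ 0) {k : ℕ}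
    (hk : (64 : ZMod p) ^ k = -3) (h : 3 ∣ orderOf (2 : ZMod p)) :
    orderOf (3 : ZMod p) < orderOf (4 : ZMod p) := by
  have h42 : (4 : ZMod p) = 2 ^ 2 := by norm_num
  have h4 : 3 ∣ orderOf (4 : ZMod p) := by
    have h1 : orderOf (2 : ZMod p) ∣ 2 * orderOf (4 : ZMod p) := by
      rw [orderOf_dvd_iff_pow_eq_one, pow_mul, ← h42, pow_orderOf_eq_one]
    exact (Nat.Coprime.dvd_mul_left (by norm_num)).mp (h.trans h1)
  have hpos : 0 < orderOf (4 : ZMod p) := by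
    rw [h42, orderOf_pos_iff]
    exact isOfFinOrder_iff_pow_eq_one.mpr ⟨p - 1, Nat.sub_pos_of_lt (Fact.out : p.Prime).one_lt,
      ZMod.pow_card_sub_one_eq_one (pow_ne_zero 2 h2)⟩
  obtain ⟨m, hm⟩ := h4
  have hpow : (3 : ZMod p) ^ (2 * m) = 1 := by
    have h64 : (64 : ZMod p) ^ m = 1 := by
      have : (64 : ZMod p) = 4 ^ 3 := by norm_num
      rw [this, ← pow_mul, ← hm, pow_orderOf_eq_one]
    rw [pow_mul, ← neg_sq, ← hk, ← pow_mul, ← pow_mul,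
      show k * (2 * m) = m * (k * 2) by ring, pow_mul, h64, one_pow]
  have := Nat.le_of_dvd (by omega) (orderOf_dvd_of_pow_eq_one hpow)
  omega

/-- Consequence of Theorem 1.3: the pair `4, 3` is order-dominant. -/
theorem order_dominant_four_three :
    {p : ℕ | p.Prime ∧ ¬ p ∣ 6 ∧
      orderOf ((3 : ZMod p)) < orderOf ((4 : ZMod p))}.Infinite := by
  refine Set.infinite_of_forall_exists_gt fun n => ?_
  set k := n.factorial
  have hk0 : k ≠ 0 := n.factorial_ne_zero
  obtain ⟨p, hp, hpN, hpcd⟩ : ∃ p : ℕ, p.Prime ∧ p ∣ 64 ^ k + 3 ∧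
      ¬ ∃ c d : ℤ, (p : ℤ) = c ^ 2 + 27 * d ^ 2 := by
    by_contra! hcon
    have := three_dvd_of_forall_prime_eq_sq_add (64 ^ k + 3) (by positivity) (8 ^ k) 1
      (by push_cast; rw [← pow_mul, mul_comm k 2, pow_mul]; norm_num)
      hcon
    omega
  have : Fact p.Prime := ⟨hp⟩
  have hN : (64 : ZMod p) ^ k = -3 := by
    rw [eq_neg_iff_add_eq_zero]
    exact_mod_cast (ZMod.natCast_eq_zero_iff _ _).mpr hpN
  have h2 : (2 : ZMod p) ≠ 0 := by
    intro h
    have h64 : (64 : ZMod p) = 0 := by linear_combination 32 * h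
    rw [h64, zero_pow hk0] at hN
    exact one_ne_zero (α := ZMod p) (by linear_combination hN - h)
  have h3 : (3 : ZMod p) ≠ 0 := by
    intro h
    have h64 : (64 : ZMod p) = 1 := by linear_combination 21 * h
    rw [h64, one_pow] at hN
    exact one_ne_zero (α := ZMod p) (by linear_combination hN - h)
  have hp6 : ¬ p ∣ 6 := by
    rw [← ZMod.natCast_eq_zero_iff]
    have : ((6 : ℕ) : ZMod p) = 2 * 3 := by norm_num
    rw [this]
    exact mul_ne_zero h2 h3
  have hx : ((8 : ZMod p) ^ k) ^ 2 = -3 := by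
    rw [← hN, ← pow_mul, mul_comm k 2, pow_mul]
    norm_num
  refine ⟨p, ⟨hp, hp6, orderOf_three_lt_orderOf_four h2 hN ?_⟩, ?_⟩
  · by_contra hord
    refine hpcd (exists_eq_sq_add_of_not_three_dvd_orderOf_two p ?_
      (three_dvd_sub_one_of_sq_eq_neg_three h2 h3 hx) hord)
    rintro rfl
    exact hp6 (by norm_num)
  · by_contra! hpn
    obtain ⟨m, hm⟩ : p - 1 ∣ k :=
      Nat.dvd_factorial (Nat.sub_pos_of_lt hp.one_lt) ((Nat.sub_le _ _).trans hpn)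
    have h64 : (64 : ZMod p) ≠ 0 := by
      have : (64 : ZMod p) = 2 ^ 6 := by norm_num
      rw [this]
      exact pow_ne_zero 6 h2
    rw [hm, pow_mul, ZMod.pow_card_sub_one_eq_one h64, one_pow] at hN
    exact pow_ne_zero 2 h2 (by linear_combination hN)
end

section
/- There are infinitely many maximal (nonzero prime) ideals P of the ring of Gaussian integers ℤ[i] such that the images of 1+i and 2+i in the residue field ℤ[i]/P are both nonzero and generate the same cyclic subgroup of the unit group (ℤ[i]/P)ˣ. -/
namespace GaussianInt

/-- The basis `1, i` of the Gaussian integers over `ℤ`. -/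
noncomputable def basisOneI : Module.Basis (Fin 2) ℤ GaussianInt :=
  Module.Basis.ofEquivFun
    { toFun := fun z => ![z.re, z.im]
      invFun := fun v => ⟨v 0, v 1⟩
      left_inv := fun z => by ext <;> simp
      right_inv := fun v => by ext j; fin_cases j <;> simp
      map_add' := fun x y => by ext j; fin_cases j <;> simp
      map_smul' := fun c x => by ext j; fin_cases j <;> simp }

theorem algebraNorm_eq (z : GaussianInt) : Algebra.norm ℤ z = z.norm := by
  have h0 : basisOneI 0 = ⟨1, 0⟩ := by simp [basisOneI]
  have h1 : basisOneI 1 = ⟨0, 1⟩ := by simp [basisOneI]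
  rw [Algebra.norm_eq_matrix_det basisOneI, Matrix.det_fin_two]
  simp only [Algebra.leftMulMatrix_eq_repr_mul, h0, h1]
  simp [basisOneI, Module.Basis.ofEquivFun_repr_apply, Zsqrtd.norm]

instance moduleFree : Module.Free ℤ GaussianInt := Module.Free.of_basis basisOneI

instance moduleFinite : Module.Finite ℤ GaussianInt := Module.Finite.of_basis basisOneI

theorem natCard_quotient_span_singleton (z : GaussianInt) :
    Nat.card (GaussianInt ⧸ Ideal.span {z}) = z.norm.natAbs := by
  rw [← algebraNorm_eq, ← Ideal.absNorm_span_singleton]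
  rfl

/-- A Gaussian integer whose norm is not `1` modulo `q` has a prime factor with the same
property. -/
theorem exists_prime_dvd_not_norm_modEq_one (q : ℤ) (z : GaussianInt) (hz : z ≠ 0)
    (h : ¬ z.norm ≡ 1 [ZMOD q]) :
    ∃ p : GaussianInt, Prime p ∧ p ∣ z ∧ ¬ p.norm ≡ 1 [ZMOD q] := by
  induction z using UniqueFactorizationMonoid.induction_on_prime with
  | h₁ => exact absurd rfl hz
  | h₂ x hx =>
    rw [← Zsqrtd.norm_eq_one_iff' (by norm_num)] at hx
    exact absurd (by rw [hx]) h
  | h₃ a p ha hp ih =>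
    by_cases h1 : p.norm ≡ 1 [ZMOD q]
    · have h2 : ¬ a.norm ≡ 1 [ZMOD q] := fun h2 => h (by
        rw [Zsqrtd.norm_mul]
        simpa using h1.mul h2)
      obtain ⟨r, hr, hra, hrn⟩ := ih ha h2
      exact ⟨r, hr, hra.mul_left p, hrn⟩
    · exact ⟨p, hp, dvd_mul_right p a, h1⟩

/-- For a prime `q ≡ 3 (mod 4)` the norm of `(1 + i) ^ q - (2 + i)` is `5` modulo `q`. -/
theorem norm_one_add_I_pow_sub_modEq_five {q : ℕ} (hq : q.Prime) (hq4 : 4 ∣ q + 1) :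
    ((⟨1, 1⟩ : GaussianInt) ^ q - ⟨2, 1⟩).norm ≡ 5 [ZMOD q] := by
  obtain ⟨r, hr⟩ := exists_add_pow_prime_eq hq (1 : GaussianInt) ⟨0, 1⟩
  have hI : (⟨0, 1⟩ : GaussianInt) ^ q = ⟨0, -1⟩ := by
    obtain ⟨k, hk⟩ := hq4
    have hk0 : k ≠ 0 := by rintro rfl; omega
    obtain ⟨m, rfl⟩ := Nat.exists_eq_succ_of_ne_zero hk0
    have hqm : q = 4 * m + 3 := by omega
    have h4 : (⟨0, 1⟩ : GaussianInt) ^ 4 = 1 := by decide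
    have h3 : (⟨0, 1⟩ : GaussianInt) ^ 3 = ⟨0, -1⟩ := by decide
    rw [hqm, pow_add, pow_mul, h4, one_pow, one_mul, h3]
  have h11 : (1 : GaussianInt) + ⟨0, 1⟩ = ⟨1, 1⟩ := by decide
  rw [h11, one_pow, hI, mul_one, mul_assoc] at hr
  generalize (⟨0, 1⟩ : GaussianInt) * r = w at hr
  rw [hr]
  apply Int.ModEq.symm
  rw [Int.modEq_iff_dvd]
  refine ⟨q * (w.re ^ 2 + w.im ^ 2) - 2 * w.re - 4 * w.im, ?_⟩
  simp [Zsqrtd.norm]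
  ring

end GaussianInt

theorem Submonoid.powers_pow_eq_of_coprime {M : Type*} [Monoid M] {x : M} {n : ℕ}
    (h : n.Coprime (orderOf x)) : Submonoid.powers (x ^ n) = Submonoid.powers x := by
  obtain ⟨m, hm⟩ := exists_pow_eq_self_of_coprime h
  apply le_antisymm
  · exact Submonoid.powers_le.2 ⟨n, rfl⟩
  · exact Submonoid.powers_le.2 ⟨m, hm⟩

/-- Two distinct nonzero elements of a domain with the same powers have finite order. -/
theorem isOfFinOrder_of_powers_eq {R : Type*} [CommRing R] [IsDomain R] {x y : R} (hx : x ≠ 0)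
    (hxy : x ≠ y) (h : Submonoid.powers x = Submonoid.powers y) : IsOfFinOrder x := by
  obtain ⟨m, hm⟩ : y ∈ Submonoid.powers x := h ▸ Submonoid.mem_powers y
  obtain ⟨k, hk⟩ : x ∈ Submonoid.powers y := h ▸ Submonoid.mem_powers x
  simp only at hm hk
  rw [isOfFinOrder_iff_pow_eq_one]
  have hmk : x ^ (m * k) = x := by rw [pow_mul, hm, hk]
  rcases Nat.lt_trichotomy (m * k) 1 with h1 | h1 | h1
  · refine ⟨1, one_pos, ?_⟩
    rw [Nat.lt_one_iff.1 h1, pow_zero] at hmk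
    rw [pow_one, hmk]
  · rw [Nat.eq_one_of_mul_eq_one_right h1, pow_one] at hm
    exact absurd hm hxy
  · refine ⟨m * k - 1, by omega, mul_right_cancel₀ hx ?_⟩
    rw [← pow_succ, Nat.sub_add_cancel h1.le, hmk, one_mul]

/-- Example after Theorem 1.4: `1 + i` and `2 + i` generate the same subgroup of
`(ℤ[i]/P)ˣ` for infinitely many maximal ideals `P` of the Gaussian integers. -/
theorem gaussian_example :
    {P : Ideal GaussianInt | P.IsMaximal ∧
      Ideal.Quotient.mk P (⟨1, 1⟩ : GaussianInt) ≠ 0 ∧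
      Ideal.Quotient.mk P (⟨2, 1⟩ : GaussianInt) ≠ 0 ∧
      Submonoid.powers (Ideal.Quotient.mk P (⟨1, 1⟩ : GaussianInt)) =
        Submonoid.powers (Ideal.Quotient.mk P (⟨2, 1⟩ : GaussianInt))}.Infinite := by
  intro hfin
  set a : GaussianInt := ⟨1, 1⟩ with ha
  set b : GaussianInt := ⟨2, 1⟩ with hb
  have hba : b - a = 1 := by decide
  have hne : ∀ P : Ideal GaussianInt, P.IsMaximal →
      Ideal.Quotient.mk P a ≠ Ideal.Quotient.mk P b :=
    fun P hP h => hP.ne_top <| by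
      rw [Ideal.eq_top_iff_one, ← hba]
      exact Ideal.Quotient.eq.1 h.symm
  -- A common exponent `L` for the ideals found so far, which also works modulo `9`.
  set L : ℕ := 24 * ∏ P ∈ hfin.toFinset, orderOf (Ideal.Quotient.mk P a)
  have hL0 : L ≠ 0 := by
    refine mul_ne_zero (by norm_num) (Finset.prod_ne_zero_iff.2 fun P hP => ?_)
    obtain ⟨hmax, ha0, -, hpow⟩ := hfin.mem_toFinset.1 hP
    exact (isOfFinOrder_of_powers_eq ha0 (hne P hmax) hpow).orderOf_pos.ne'
  obtain ⟨q, hq5, hq, hqL⟩ :=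
    Nat.forall_exists_prime_gt_and_zmodEq 5 (a := -1) hL0 isCoprime_one_left.neg_left
  have hLq : L ∣ q + 1 := by
    have := Int.modEq_iff_dvd.1 hqL.symm
    rw [sub_neg_eq_add] at this
    exact_mod_cast this
  have h24 : 24 ∣ q + 1 := (dvd_mul_right _ _).trans hLq
  set x := a ^ q - b with hx
  have hax : a * x = (a ^ (q + 1) - 1) - 3 * ⟨0, 1⟩ := by
    have hab : a * b = 1 + 3 * ⟨0, 1⟩ := by decide
    rw [hx, mul_sub, ← pow_succ', hab]
    ring
  have h9 : (9 : GaussianInt) ∣ a ^ (q + 1) - 1 := by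
    obtain ⟨m, hm⟩ := h24
    have ha24 : a ^ 24 = 4096 := by decide
    rw [hm, pow_mul, ha24]
    have h : (4096 : GaussianInt) - 1 ∣ 4096 ^ m - 1 := by
      simpa using sub_dvd_pow_sub_pow (4096 : GaussianInt) 1 m
    exact Dvd.dvd.trans ⟨455, by norm_num⟩ h
  obtain ⟨u, hu⟩ := h9
  have hI : (⟨0, 1⟩ : GaussianInt) * ⟨0, 1⟩ = -1 := by decide
  rw [hu] at hax
  obtain ⟨y, hy⟩ : (3 : GaussianInt) ∣ x := by
    have h2 : (⟨1, -1⟩ : GaussianInt) * a = 2 := by decide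
    exact ⟨x - ⟨1, -1⟩ * (3 * u - ⟨0, 1⟩), by linear_combination (-⟨1, -1⟩) * hax + x * h2⟩
  have hay : a * y = 3 * u - ⟨0, 1⟩ := by
    have h3 : (3 : GaussianInt) ≠ 0 := by decide
    apply mul_left_cancel₀ h3
    linear_combination hax - a * hy
  have h3y : IsCoprime 3 y :=
    ⟨-(u * ⟨0, 1⟩), a * ⟨0, 1⟩, by linear_combination ⟨0, 1⟩ * hay - hI⟩
  have hynorm : ¬ y.norm ≡ 1 [ZMOD q] := by
    intro h
    have h5 := GaussianInt.norm_one_add_I_pow_sub_modEq_five hq (Dvd.dvd.trans (by norm_num) h24)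
    rw [← ha, ← hb, ← hx, hy, Zsqrtd.norm_mul] at h5
    have h94 : (9 : ℤ) ≡ 5 [ZMOD q] := by
      have := (h.mul_left 9).symm
      exact this.trans h5
    have h4 := Int.modEq_iff_dvd.1 h94.symm
    norm_num at h4
    have : q ∣ 4 := by exact_mod_cast h4
    exact absurd (Nat.le_of_dvd (by norm_num) this) (by omega)
  have hy0 : y ≠ 0 := by
    rintro rfl
    rw [isCoprime_zero_right, ← Zsqrtd.norm_eq_one_iff' (by norm_num)] at h3y
    exact absurd h3y (by decide)
  obtain ⟨p, hp, hpy, hpn⟩ := GaussianInt.exists_prime_dvd_not_norm_modEq_one q y hy0 hynorm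
  set P : Ideal GaussianInt := Ideal.span {p} with hP
  have hmax : P.IsMaximal := PrincipalIdealRing.isMaximal_of_irreducible hp.irreducible
  have hxP : Ideal.Quotient.mk P a ^ q = Ideal.Quotient.mk P b := by
    rw [← map_pow, Ideal.Quotient.eq, ← hx, Ideal.mem_span_singleton, hy]
    exact hpy.mul_left 3
  have ha0 : Ideal.Quotient.mk P a ≠ 0 := fun h => hne P hmax <| by
    rw [← hxP, h, zero_pow hq.ne_zero]
  have hb0 : Ideal.Quotient.mk P b ≠ 0 := hxP ▸ pow_ne_zero q ha0
  have hcop : q.Coprime (orderOf (Ideal.Quotient.mk P a)) := by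
    rw [hq.coprime_iff_not_dvd]
    intro hdvd
    apply hpn
    have hcard : Nat.card (GaussianInt ⧸ P) = p.norm.natAbs :=
      GaussianInt.natCard_quotient_span_singleton p
    have hnorm : p.norm.natAbs ≠ 0 := by
      rw [Int.natAbs_ne_zero, Ne, GaussianInt.norm_eq_zero]
      exact hp.ne_zero
    have hfinite : Finite (GaussianInt ⧸ P) := Nat.finite_of_card_ne_zero (hcard ▸ hnorm)
    let : Field (GaussianInt ⧸ P) := Ideal.Quotient.field P
    let : Fintype (GaussianInt ⧸ P) := Fintype.ofFinite _
    have h1 := hdvd.trans (orderOf_dvd_of_pow_eq_one (FiniteField.pow_card_sub_one_eq_one _ ha0))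
    rw [← Nat.card_eq_fintype_card, hcard] at h1
    have h2 := (Nat.modEq_iff_dvd' (Nat.one_le_iff_ne_zero.2 hnorm)).2 h1
    have h3 := (Int.natCast_modEq_iff.2 h2).symm
    rwa [Int.natAbs_of_nonneg (GaussianInt.norm_nonneg p)] at h3
  have hpow : Submonoid.powers (Ideal.Quotient.mk P a) =
      Submonoid.powers (Ideal.Quotient.mk P b) := by
    rw [← hxP, Submonoid.powers_pow_eq_of_coprime hcop]
  have hmem : P ∈ hfin.toFinset := hfin.mem_toFinset.2 ⟨hmax, ha0, hb0, hpow⟩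
  have hord : orderOf (Ideal.Quotient.mk P a) ∣ q + 1 :=
    ((Finset.dvd_prod_of_mem _ hmem).trans (dvd_mul_left _ _)).trans hLq
  have hpa : p ∣ 9 * u := by
    rw [← hu, ← Ideal.mem_span_singleton, ← hP, ← Ideal.Quotient.eq, map_pow, map_one]
    exact orderOf_dvd_iff_pow_eq_one.1 hord
  have hp3 : p ∣ 3 := by
    have h : (3 : GaussianInt) = (a * x - 9 * u) * ⟨0, 1⟩ := by
      linear_combination (-⟨0, 1⟩) * hax + 3 * hI
    rw [h, hy]
    exact (((hpy.mul_left 3).mul_left a).sub hpa).mul_right _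
  exact hp.not_isUnit (h3y.isUnit_of_dvd' hp3 hpy)
end
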